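/- arXiv:1405.6560 — 2 statements merged into one kernel-verified Lean document; each statement's English description precedes it below -/
import Mathlib

section
/- Let ε > 0. If n is sufficiently large and the graph H is an (n, ε log n / log log n)-expander, then H contains a Hamilton cycle. -/
/-- The neighbourhood `N(U)` of a vertex set `U`: all vertices outside `U` with a
neighbour in `U`. -/
def nbr {V : Type*} (G : SimpleGraph V) (U : Finset V) : Set V :=
  {v | v ∉ U ∧ ∃ u ∈ U, G.Adj u v}

/-- `G` is an `(n,d)`-expander: it has `n` vertices, `|N(X)| ≥ d|X|` for every `X` with
`1 ≤ |X| < ⌈n/2d⌉`, and any two disjoint sets of size `⌈n/2d⌉` have an edge between them. -/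
def IsExpander {V : Type*} [Fintype V] (G : SimpleGraph V) (n : ℕ) (d : ℝ) : Prop :=
  Fintype.card V = n ∧
  (∀ X : Finset V, 1 ≤ X.card → X.card < ⌈(n : ℝ) / (2 * d)⌉₊ →
    d * X.card ≤ ((nbr G X).ncard : ℝ)) ∧
  (∀ X Y : Finset V, Disjoint X Y → X.card = ⌈(n : ℝ) / (2 * d)⌉₊ →
    Y.card = ⌈(n : ℝ) / (2 * d)⌉₊ → ∃ x ∈ X, ∃ y ∈ Y, G.Adj x y)

namespace Expander

variable {V : Type*}

/-- The vertices `u` and `v` are consecutive, in either order, in the list `L`. -/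
def Consec (L : List V) (u v : V) : Prop := [u, v] <:+: L ∨ [v, u] <:+: L

lemma Consec.symm {L : List V} {u v : V} (h : Consec L u v) : Consec L v u := Or.symm h

lemma Consec.reverse {L : List V} {u v : V} (h : Consec L u v) : Consec L.reverse u v := by
  rcases h with h | h
  · right; simpa using List.reverse_infix.2 h
  · left; simpa using List.reverse_infix.2 h

lemma Consec.mono {L L' : List V} {u v : V} (h : Consec L u v) (hL : L <:+: L') :
    Consec L' u v :=
  h.imp (fun h => h.trans hL) (fun h => h.trans hL)

lemma pair_infix_append {M N : List V} {u v : V} (h : [u, v] <:+: M ++ N) :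
    [u, v] <:+: M ∨ [u, v] <:+: N ∨ (M.getLast? = some u ∧ N.head? = some v) := by
  obtain ⟨s, t, h⟩ := h
  rw [List.append_assoc, List.append_eq_append_iff] at h
  rcases h with ⟨a, h1, h2⟩ | ⟨a, h1, h2⟩
  · rcases a with _ | ⟨x, _ | ⟨y, a⟩⟩
    · right; left; exact ⟨[], t, by simpa using h2⟩
    · right; right
      simp at h2
      simp [h1, h2.1, ← h2.2]
    · left
      simp at h2
      exact ⟨s, a, by simp [h1, h2]⟩
  · right; left
    exact ⟨a, t, by simp [h2]⟩

lemma Consec.of_append {M N : List V} {u v : V} (h : Consec (M ++ N) u v) :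
    Consec M u v ∨ Consec N u v ∨ (M.getLast? = some u ∧ N.head? = some v) ∨
      (M.getLast? = some v ∧ N.head? = some u) := by
  rcases h with h | h
  · rcases pair_infix_append h with h | h | h
    · exact .inl (.inl h)
    · exact .inr (.inl (.inl h))
    · exact .inr (.inr (.inl h))
  · rcases pair_infix_append h with h | h | h
    · exact .inl (.inr h)
    · exact .inr (.inl (.inr h))
    · exact .inr (.inr (.inr h))

lemma Consec.mem_left {L : List V} {u v : V} (h : Consec L u v) : u ∈ L := by
  rcases h with h | h <;> exact h.subset (by simp)

lemma Consec.mem_right {L : List V} {u v : V} (h : Consec L u v) : v ∈ L := h.symm.mem_left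

variable (G : SimpleGraph V)

/-- `L` lists the vertices of a path of `G` in order. -/
def IsListPath (L : List V) : Prop := L.IsChain G.Adj ∧ L.Nodup

variable {G}

lemma IsListPath.reverse {L : List V} (h : IsListPath G L) : IsListPath G L.reverse := by
  refine ⟨?_, List.nodup_reverse.2 h.2⟩
  rw [List.isChain_reverse]
  simpa [G.adj_comm] using h.1

variable (G) in
/-- `Rot G P t L` means that `L` arises from `P` by at most `t` Pósa rotations at the head. -/
inductive Rot (P : List V) : ℕ → List V → Prop
  | refl : Rot P 0 P
  | mono {t : ℕ} {L : List V} : Rot P t L → Rot P (t + 1) L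
  | step {t : ℕ} {y x : V} {l₁ l₂ : List V} : Rot P t (y :: l₁ ++ x :: l₂) → G.Adj y x →
      Rot P (t + 1) ((y :: l₁).reverse ++ x :: l₂)

variable (G) in
/-- `y` is the first vertex of a list obtained from `P` by at most `t` rotations. -/
def Head (P : List V) (t : ℕ) (y : V) : Prop := ∃ l, Rot G P t (y :: l)

lemma Head.mono {P : List V} {t : ℕ} {y : V} (h : Head G P t y) : Head G P (t + 1) y :=
  h.imp fun _ => Rot.mono

lemma Head.mono_le {P : List V} {t t' : ℕ} {y : V} (h : Head G P t y) (ht : t ≤ t') :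
    Head G P t' y := by
  induction ht with
  | refl => exact h
  | step _ ih => exact ih.mono

lemma Rot.perm {P : List V} {t : ℕ} {L : List V} (h : Rot G P t L) : L.Perm P := by
  induction h with
  | refl => exact .refl _
  | mono _ ih => exact ih
  | step _ _ ih => exact ((List.reverse_perm _).append_right _).trans ih

lemma Rot.isListPath {P : List V} {t : ℕ} {L : List V} (h : Rot G P t L)
    (hP : IsListPath G P) : IsListPath G L := by
  refine ⟨?_, h.perm.nodup_iff.2 hP.2⟩
  induction h with
  | refl => exact hP.1
  | mono _ ih => exact ih
  | step _ hadj ih =>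
    rw [List.isChain_append] at ih ⊢
    refine ⟨?_, ih.2.1, ?_⟩
    · rw [List.isChain_reverse]
      simpa [G.adj_comm] using ih.1
    · simpa using hadj

lemma Rot.getLast?_eq {P : List V} {t : ℕ} {L : List V} (h : Rot G P t L) :
    L.getLast? = P.getLast? := by
  induction h with
  | refl => rfl
  | mono _ ih => exact ih
  | step _ _ ih => rw [← ih]; simp only [List.getLast?_append, List.getLast?_cons, Option.some_or]

lemma consec_rotate {l₁ l₂ : List V} {x u v : V} (h : Consec (l₁ ++ x :: l₂) u v) :
    Consec (l₁.reverse ++ x :: l₂) u v ∨ (l₁.getLast? = some u ∧ v = x) ∨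
      (l₁.getLast? = some v ∧ u = x) := by
  rcases h.of_append with h | h | h | h
  · exact .inl (h.reverse.mono (List.prefix_append _ _).isInfix)
  · exact .inl (h.mono (List.suffix_append _ _).isInfix)
  · exact .inr (.inl ⟨h.1, by simpa using h.2.symm⟩)
  · exact .inr (.inr ⟨h.1, by simpa using h.2.symm⟩)

lemma head_reverse {P : List V} {t : ℕ} {l₁ l₂ : List V} {u : V}
    (h : Rot G P t (l₁.reverse ++ l₂)) (hu : l₁.getLast? = some u) : Head G P t u := by
  obtain ⟨l, rfl⟩ := List.getLast?_eq_some_iff.1 hu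
  exact ⟨l.reverse ++ l₂, by simpa using h⟩

lemma Rot.consec_or_head {P : List V} {t : ℕ} {L : List V} (h : Rot G P t L) {u v : V}
    (huv : Consec P u v) : Consec L u v ∨ Head G P t u ∨ Head G P t v := by
  induction h with
  | refl => exact .inl huv
  | mono _ ih => exact ih.imp_right (Or.imp Head.mono Head.mono)
  | step h hadj ih =>
    rcases ih with ih | ih
    · rcases consec_rotate ih with h' | h' | h'
      · exact .inl h'
      · exact .inr (.inl (head_reverse (h.step hadj) h'.1))
      · exact .inr (.inr (head_reverse (h.step hadj) h'.1))
    · exact .inr (ih.imp Head.mono Head.mono)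

lemma Rot.exists_broken [DecidableEq V] {P : List V} {t : ℕ} {L : List V} (h : Rot G P t L) :
    ∃ F : Finset (Sym2 V), F.card ≤ t ∧ ∀ u v, Consec P u v → Consec L u v ∨ s(u, v) ∈ F := by
  induction h with
  | refl => exact ⟨∅, by simp, fun u v h => .inl h⟩
  | mono _ ih =>
    obtain ⟨F, hF, h⟩ := ih
    exact ⟨F, by omega, h⟩
  | @step t y x l₁ l₂ h hadj ih =>
    obtain ⟨F, hF, h⟩ := ih
    refine ⟨insert s((y :: l₁).getLast (by simp), x) F,
      (Finset.card_insert_le _ _).trans (by omega), fun u v huv => ?_⟩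
    rcases h u v huv with h | h
    · rcases consec_rotate h with h' | h' | h'
      · exact .inl h'
      · right
        rw [List.getLast?_eq_some_getLast (by simp)] at h'
        simp at h'
        simp [h'.1, h'.2]
      · right
        rw [List.getLast?_eq_some_getLast (by simp)] at h'
        simp at h'
        simp [h'.1, h'.2, Sym2.eq_swap]
    · exact .inr (by simp [h])

lemma Consec.eq_of_nodup {l₁ l₂ : List V} {x z : V} (hn : (l₁ ++ x :: l₂).Nodup)
    (h : Consec (l₁ ++ x :: l₂) x z) : l₁.getLast? = some z ∨ l₂.head? = some z := by
  have hx₁ : x ∉ l₁ := by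
    intro hx
    exact (List.nodup_append.1 hn).2.2 x hx x (by simp) rfl
  have hx₂ : x ∉ l₂ := (List.nodup_cons.1 (List.nodup_append.1 hn).2.1).1
  rcases h.of_append with h | h | h | h
  · exact absurd h.mem_left hx₁
  · have h' : Consec ([x] ++ l₂) x z := h
    rcases h'.of_append with h | h | h | h
    · rcases h with h | h <;> simpa using h.length_le
    · exact absurd h.mem_left hx₂
    · exact .inr h.2
    · exact absurd (List.mem_of_mem_head? (by simp [h.2])) hx₂
  · exact absurd (List.mem_of_mem_getLast? (by simp [h.1])) hx₁
  · exact .inl h.1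

/-- **Pósa's lemma.** -/
lemma Rot.posa {P : List V} (hP : P.Nodup) {t : ℕ} {y : V} {l : List V}
    (h : Rot G P t (y :: l)) {x z₁ z₂ : V} (hx : x ∈ y :: l) (hadj : G.Adj y x)
    (hz : z₁ ≠ z₂) (h₁ : Consec P x z₁) (h₂ : Consec P x z₂) :
    Head G P (t + 1) x ∨ Head G P (t + 1) z₁ ∨ Head G P (t + 1) z₂ := by
  have hxl : x ∈ l := by
    rcases List.mem_cons.1 hx with rfl | h
    · exact absurd hadj (G.irrefl)
    · exact h
  obtain ⟨l₁, l₂, rfl⟩ := List.append_of_mem hxl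
  have hn : (y :: l₁ ++ x :: l₂).Nodup := h.perm.nodup_iff.2 hP
  rcases h.consec_or_head h₁ with c₁ | c₁ | c₁
  · rcases h.consec_or_head h₂ with c₂ | c₂ | c₂
    · have hr : Rot G P (t + 1) ((y :: l₁).reverse ++ x :: l₂) := Rot.step h hadj
      rcases Consec.eq_of_nodup hn c₁ with e₁ | e₁
      · exact .inr (.inl (head_reverse hr e₁))
      · rcases Consec.eq_of_nodup hn c₂ with e₂ | e₂
        · exact .inr (.inr (head_reverse hr e₂))
        · exact absurd (by simpa using e₁.symm.trans e₂) hz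
    · exact .inl c₂.mono
    · exact .inr (.inr c₂.mono)
  · exact .inl c₁.mono
  · exact .inr (.inl c₁.mono)

lemma exists_isHamiltonianCycle_of_isListPath [DecidableEq V] {L : List V}
    (hL : IsListPath G L) (hall : ∀ v, v ∈ L) (h3 : 3 ≤ L.length) {y z : V}
    (hy : L.head? = some y) (hz : L.getLast? = some z) (hadj : G.Adj z y) :
    ∃ (v : V) (c : G.Walk v v), c.IsHamiltonianCycle := by
  have hne : L ≠ [] := by rintro rfl; simp at hy
  have hy' : L.head hne = y := by
    rw [List.head?_eq_some_head hne] at hy; simpa using hy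
  have hz' : L.getLast hne = z := by
    rw [List.getLast?_eq_some_getLast hne] at hz; simpa using hz
  have hadj' : G.Adj (L.getLast hne) (L.head hne) := by rw [hy', hz']; exact hadj
  have hs := SimpleGraph.Walk.support_ofSupport hne hL.1
  have hlen := SimpleGraph.Walk.length_ofSupport hne hL.1
  have hpath : (SimpleGraph.Walk.ofSupport L hne hL.1).IsPath := by
    rw [SimpleGraph.Walk.isPath_def, hs]; exact hL.2
  refine ⟨_, SimpleGraph.Walk.cons hadj' (SimpleGraph.Walk.ofSupport L hne hL.1), ?_⟩
  rw [SimpleGraph.Walk.isHamiltonianCycle_iff_isCycle_and_support_count_tail_eq_one]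
  refine ⟨?_, ?_⟩
  · rw [SimpleGraph.Walk.cons_isCycle_iff]
    refine ⟨hpath, fun hmem => ?_⟩
    have := hpath.length_eq_one_of_mem_edges (Sym2.eq_swap ▸ hmem)
    omega
  · intro a
    rw [SimpleGraph.Walk.support_cons, List.tail_cons, hs]
    exact List.count_eq_one_of_mem hL.2 (hall a)

end Expander

namespace Expander

variable {V : Type*} {G : SimpleGraph V}

section Position
variable [DecidableEq V]

/-- The vertex preceding `v` in `L`. -/
def prv (L : List V) (v : V) : V := L.getD (L.idxOf v - 1) v

/-- The vertex following `v` in `L`. -/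
def nxt (L : List V) (v : V) : V := L.getD (L.idxOf v + 1) v

/-- `v` is neither the first nor the last vertex of `L`. -/
def Inner (L : List V) (v : V) : Prop := 0 < L.idxOf v ∧ L.idxOf v + 1 < L.length

omit [DecidableEq V] in
lemma consec_getElem {L : List V} {i : ℕ} (h : i + 1 < L.length) :
    Consec L (L[i]'(by omega)) L[i + 1] := by
  refine .inl ⟨L.take i, L.drop (i + 2), ?_⟩
  conv_rhs => rw [← List.take_append_drop i L, List.drop_eq_getElem_cons (by omega),
    List.drop_eq_getElem_cons h]
  simp

lemma Inner.prv_eq {L : List V} {v : V} (h : Inner L v) :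
    prv L v = L[L.idxOf v - 1]'(by have := h.2; omega) :=
  List.getD_eq_getElem _ _ _

lemma Inner.nxt_eq {L : List V} {v : V} (h : Inner L v) : nxt L v = L[L.idxOf v + 1]'h.2 :=
  List.getD_eq_getElem _ _ _

lemma Inner.consec_nxt {L : List V} {v : V} (h : Inner L v) : Consec L v (nxt L v) := by
  have := consec_getElem h.2
  rwa [List.getElem_idxOf, ← h.nxt_eq] at this

lemma Inner.consec_prv {L : List V} {v : V} (h : Inner L v) : Consec L v (prv L v) := by
  have h1 := h.1
  have h2 := h.2
  have := consec_getElem (L := L) (i := L.idxOf v - 1) (by omega)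
  simp only [Nat.sub_add_cancel h1, List.getElem_idxOf] at this
  rw [h.prv_eq]
  exact this.symm

lemma Inner.prv_ne_nxt {L : List V} (hL : L.Nodup) {v : V} (h : Inner L v) :
    prv L v ≠ nxt L v := by
  rw [h.prv_eq, h.nxt_eq, Ne, hL.getElem_inj_iff]
  omega

lemma Inner.mem {L : List V} {v : V} (h : Inner L v) : v ∈ L :=
  List.idxOf_lt_length_iff.1 (by have := h.2; omega)

lemma prv_injOn {L : List V} (hL : L.Nodup) : Set.InjOn (prv L) {v | Inner L v} := by
  intro v hv w hw h
  rw [hv.prv_eq, hw.prv_eq, hL.getElem_inj_iff] at h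
  have := hv.1
  have := hw.1
  exact (List.idxOf_inj hv.mem).1 (by omega)

lemma nxt_injOn {L : List V} (hL : L.Nodup) : Set.InjOn (nxt L) {v | Inner L v} := by
  intro v hv w hw h
  rw [hv.nxt_eq, hw.nxt_eq, hL.getElem_inj_iff] at h
  exact (List.idxOf_inj hv.mem).1 (by omega)

lemma inner_or {L : List V} {v : V} (hv : v ∈ L) :
    L.head? = some v ∨ L.getLast? = some v ∨ Inner L v := by
  have hlt := List.idxOf_lt_length_iff.2 hv
  by_cases h0 : L.idxOf v = 0
  · left
    rw [List.head?_eq_getElem?, ← h0, List.getElem?_eq_getElem hlt, List.getElem_idxOf]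
  · by_cases h1 : L.idxOf v + 1 = L.length
    · right; left
      rw [List.getLast?_eq_getElem?, show L.length - 1 = L.idxOf v by omega,
        List.getElem?_eq_getElem hlt, List.getElem_idxOf]
    · exact .inr (.inr ⟨by omega, by omega⟩)

end Position

variable (G) in
/-- Any two disjoint sets of at least `m` vertices are joined by an edge. -/
def Joined (m : ℕ) : Prop :=
  ∀ X Y : Finset V, Disjoint X Y → m ≤ X.card → m ≤ Y.card → ∃ x ∈ X, ∃ y ∈ Y, G.Adj x y

section Fin
variable [DecidableEq V]

lemma card_filter_three_le (I T : Finset V) {a b : V → V} (ha : Set.InjOn a I)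
    (hb : Set.InjOn b I) : (T ∪ I.filter fun x => a x ∈ T ∨ b x ∈ T).card ≤ 3 * T.card := by
  have h1 : (I.filter fun x => a x ∈ T).card ≤ T.card :=
    Finset.card_le_card_of_injOn a (by intro x hx; simpa using (Finset.mem_filter.1 hx).2)
      (ha.mono (by intro x hx; exact (Finset.mem_filter.1 hx).1))
  have h2 : (I.filter fun x => b x ∈ T).card ≤ T.card :=
    Finset.card_le_card_of_injOn b (by intro x hx; simpa using (Finset.mem_filter.1 hx).2)
      (hb.mono (by intro x hx; exact (Finset.mem_filter.1 hx).1))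
  rw [Finset.filter_or]
  have h3 := Finset.card_union_le T
    ((I.filter fun x => a x ∈ T) ∪ I.filter fun x => b x ∈ T)
  have h4 := Finset.card_union_le (I.filter fun x => a x ∈ T) (I.filter fun x => b x ∈ T)
  omega

variable (G) in
/-- Every vertex of `I` with a neighbour in `T` lies in `T` or is mapped into `T` by `a` or `b`. -/
def RotClosed (I : Finset V) (a b : V → V) (T : Finset V) : Prop :=
  ∀ x ∈ I, (∃ y ∈ T, G.Adj y x) → x ∈ T ∨ a x ∈ T ∨ b x ∈ T

lemma RotClosed.two_mul_le {m : ℕ} (hJ : Joined G m) {I : Finset V} {a b : V → V}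
    (ha : Set.InjOn a I) (hb : Set.InjOn b I) (hI : 7 * m ≤ I.card) {T : Finset V}
    (hT : RotClosed G I a b T) (hm : m ≤ T.card) : 2 * m ≤ T.card := by
  by_contra! hlt
  have h3 := card_filter_three_le I T ha hb
  have hsd := Finset.le_card_sdiff (T ∪ I.filter fun x => a x ∈ T ∨ b x ∈ T) I
  obtain ⟨x, hx, y, hy, hxy⟩ := hJ T (I \ (T ∪ I.filter fun x => a x ∈ T ∨ b x ∈ T))
    (Finset.disjoint_left.2 fun x hx hx' => by simp [hx] at hx') hm (by omega)
  simp only [Finset.mem_sdiff, Finset.mem_union, Finset.mem_filter] at hy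
  have := hT y hy.1 ⟨x, hx, hxy⟩
  tauto

lemma RotClosed.union {I : Finset V} {a b : V → V} {S T : Finset V}
    (hS : RotClosed G I a b S) (hT : RotClosed G I a b T) : RotClosed G I a b (S ∪ T) := by
  rintro x hx ⟨y, hy, hyx⟩
  simp only [Finset.mem_union] at hy ⊢
  rcases hy with hy | hy
  · have := hS x hx ⟨y, hy, hyx⟩
    tauto
  · have := hT x hx ⟨y, hy, hyx⟩
    tauto

variable [Fintype V]

/-- Apart from few exceptional vertices `v`, closed sets containing `v` are large. -/
lemma exists_exceptional {m : ℕ} (hm : 0 < m) (hJ : Joined G m) {I : Finset V} {a b : V → V}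
    (ha : Set.InjOn a I) (hb : Set.InjOn b I) (hI : 7 * m ≤ I.card) :
    ∃ D : Finset V, D.card < 2 * m ∧
      ∀ T, RotClosed G I a b T → ∀ v ∈ T, v ∉ D → m ≤ T.card := by
  classical
  obtain ⟨Z, hZ, hmax⟩ := Finset.exists_max_image
    (Finset.univ.filter fun T : Finset V => RotClosed G I a b T ∧ T.card < m) Finset.card
    ⟨∅, by simpa [RotClosed] using hm⟩
  simp only [Finset.mem_filter, Finset.mem_univ, true_and] at hZ hmax
  set C := I \ (Z ∪ I.filter fun x => a x ∈ Z ∨ b x ∈ Z) with hC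
  have hCcard : 2 * m ≤ C.card := by
    have h3 := card_filter_three_le I Z ha hb
    have hsd := Finset.le_card_sdiff (Z ∪ I.filter fun x => a x ∈ Z ∨ b x ∈ Z) I
    rw [← hC] at hsd
    omega
  refine ⟨Finset.univ.filter fun v => ∀ x ∈ C, ¬ G.Adj v x, ?_, ?_⟩
  · by_contra! hlt
    obtain ⟨C', hC', hcard⟩ := Finset.exists_subset_card_eq (show m ≤ C.card by omega)
    have hsd := Finset.le_card_sdiff C' (Finset.univ.filter fun v => ∀ x ∈ C, ¬ G.Adj v x)
    obtain ⟨x, hx, y, hy, hxy⟩ := hJ C' _ Finset.disjoint_sdiff hcard.ge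
      (show m ≤ ((Finset.univ.filter fun v => ∀ x ∈ C, ¬ G.Adj v x) \ C').card by omega)
    simp only [Finset.mem_sdiff, Finset.mem_filter, Finset.mem_univ, true_and] at hy
    exact hy.1 x (hC' hx) hxy.symm
  · intro T hT v hv hvD
    by_contra! hlt
    simp only [Finset.mem_filter, Finset.mem_univ, true_and, not_forall, not_not] at hvD
    obtain ⟨x, hx, hvx⟩ := hvD
    have hU := hZ.1.union hT
    have hUc := Finset.card_union_le Z T
    have hUm : (Z ∪ T).card < m := by
      by_contra! h
      have := hU.two_mul_le hJ ha hb hI h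
      omega
    have heq : Z = Z ∪ T :=
      Finset.eq_of_subset_of_card_le Finset.subset_union_left (hmax _ ⟨hU, hUm⟩)
    have hvZ : v ∈ Z := heq ▸ Finset.mem_union_right _ hv
    simp only [hC, Finset.mem_sdiff, Finset.mem_union, Finset.mem_filter] at hx
    have := hZ.1 x hx.1 ⟨v, hvZ, hvx⟩
    tauto

open Classical in
variable (G) in
/-- The set of first vertices of lists obtained from `P` by at most `t` rotations. -/
noncomputable def heads (P : List V) (t : ℕ) : Finset V := Finset.univ.filter (Head G P t)

omit [DecidableEq V] in
@[simp] lemma mem_heads {P : List V} {t : ℕ} {v : V} : v ∈ heads G P t ↔ Head G P t v := by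
  simp [heads]

open Classical in
variable (G) in
/-- The set of all vertices in `X` or with a neighbour in `X`. -/
noncomputable def closedNbr (X : Finset V) : Finset V :=
  Finset.univ.filter fun v => v ∈ X ∨ ∃ u ∈ X, G.Adj u v

@[simp] lemma mem_closedNbr {X : Finset V} {v : V} :
    v ∈ closedNbr G X ↔ v ∈ X ∨ ∃ u ∈ X, G.Adj u v := by
  simp [closedNbr]

lemma Joined.card_le {m : ℕ} (hJ : Joined G m) {X : Finset V} (hX : m ≤ X.card) :
    Fintype.card V ≤ m + (closedNbr G X).card := by
  by_contra! hlt
  obtain ⟨x, hx, y, hy, hxy⟩ := hJ X (closedNbr G X)ᶜ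
    (Finset.disjoint_left.2 fun x hx hx' => by simp [hx] at hx') hX
    (by rw [Finset.card_compl]; omega)
  simp only [Finset.mem_compl, mem_closedNbr] at hy
  exact hy (.inr ⟨x, hx, hxy⟩)

variable (G) in
/-- `P` is a longest path of `G`. -/
def IsLongest (P : List V) : Prop :=
  IsListPath G P ∧ ∀ L, IsListPath G L → L.length ≤ P.length

omit [DecidableEq V] [Fintype V] in
lemma IsLongest.rot {P L : List V} (hP : IsLongest G P) {t : ℕ} (h : Rot G P t L) :
    IsLongest G L :=
  ⟨h.isListPath hP.1, fun L' hL' => h.perm.length_eq ▸ hP.2 L' hL'⟩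

omit [DecidableEq V] [Fintype V] in
lemma IsLongest.reverse {P : List V} (hP : IsLongest G P) : IsLongest G P.reverse :=
  ⟨hP.1.reverse, fun L' hL' => by simpa using hP.2 L' hL'⟩

omit [DecidableEq V] in
lemma exists_isLongest (G : SimpleGraph V) : ∃ P, IsLongest G P := by
  classical
  have hb : ∀ L, IsListPath G L → L.length ≤ Fintype.card V := fun L hL =>
    hL.2.length_le_card
  have h0 : IsListPath G ([] : List V) := ⟨.nil, .nil⟩
  obtain ⟨P, hP, h⟩ := Nat.findGreatest_spec (P := fun k => ∃ L, IsListPath G L ∧ L.length = k)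
    (Nat.zero_le (Fintype.card V)) ⟨[], h0, rfl⟩
  exact ⟨P, hP, fun L hL => h ▸ Nat.le_findGreatest (hb L hL) ⟨L, hL, rfl⟩⟩

omit [DecidableEq V] [Fintype V] in
lemma IsLongest.mem_of_adj {y x : V} {l : List V} (hP : IsLongest G (y :: l))
    (h : G.Adj y x) : x ∈ y :: l := by
  by_contra hx
  have := hP.2 (x :: y :: l)
    ⟨List.isChain_cons_cons.2 ⟨h.symm, hP.1.1⟩, List.nodup_cons.2 ⟨hx, hP.1.2⟩⟩
  simp at this

lemma IsLongest.closedNbr_heads {P : List V} (hP : IsLongest G P) (t : ℕ) :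
    (closedNbr G (heads G P t)).card ≤ P.length ∧
      (closedNbr G (heads G P t)).card ≤ 3 * (heads G P (t + 1)).card + 1 := by
  classical
  have hsub : ∀ v ∈ closedNbr G (heads G P t), v ∈ P := by
    intro v hv
    simp only [mem_closedNbr, mem_heads] at hv
    rcases hv with ⟨l, hl⟩ | ⟨u, ⟨l, hl⟩, huv⟩
    · exact hl.perm.subset (by simp)
    · exact hl.perm.subset ((hP.rot hl).mem_of_adj huv)
  refine ⟨?_, ?_⟩
  · rw [← List.toFinset_card_of_nodup hP.1.2]
    exact Finset.card_le_card fun v hv => List.mem_toFinset.2 (hsub v hv)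
  · have hinj : ∀ {f : V → V}, Set.InjOn f {v | Inner P v} →
        Set.InjOn f (Finset.univ.filter fun v => Inner P v : Finset V) :=
      fun h => h.mono (by simp)
    have h3 := card_filter_three_le (Finset.univ.filter fun v => Inner P v) (heads G P (t + 1))
      (hinj (prv_injOn hP.1.2)) (hinj (nxt_injOn hP.1.2))
    set W := heads G P (t + 1) ∪ (Finset.univ.filter fun v => Inner P v).filter
      (fun x => prv P x ∈ heads G P (t + 1) ∨ nxt P x ∈ heads G P (t + 1)) with hW
    have hcov : closedNbr G (heads G P t) ⊆ W ∪ P.getLast?.toFinset := by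
      intro v hv
      have hvP := hsub v hv
      simp only [hW, Finset.mem_union, Finset.mem_filter, Finset.mem_univ, true_and, mem_heads,
        Option.mem_toFinset, Option.mem_def]
      rcases inner_or hvP with h | h | h
      · obtain ⟨l, rfl⟩ := List.head?_eq_some_iff.1 h
        exact .inl (.inl (Head.mono_le ⟨l, Rot.refl⟩ (Nat.zero_le _)))
      · exact .inr h
      · left
        simp only [mem_closedNbr, mem_heads] at hv
        rcases hv with hv | ⟨u, ⟨l, hl⟩, huv⟩
        · exact .inl hv.mono
        · have := hl.posa hP.1.2 (hl.perm.mem_iff.2 hvP) huv (h.prv_ne_nxt hP.1.2)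
            h.consec_prv h.consec_nxt
          tauto
    refine (Finset.card_le_card hcov).trans ((Finset.card_union_le _ _).trans ?_)
    have : P.getLast?.toFinset.card ≤ 1 := by
      rcases P.getLast? <;> simp
    omega

omit [DecidableEq V] [Fintype V] in
lemma IsLongest.mem_of_closed {L : List V} (hL : IsLongest G L) {y z : V}
    (hy : L.head? = some y) (hz : L.getLast? = some z) (hadj : G.Adj z y)
    (hconn : ∀ W : Finset V, W.Nonempty → (∃ v, v ∉ W) → ∃ u ∈ W, ∃ v, v ∉ W ∧ G.Adj u v)
    (v : V) : v ∈ L := by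
  classical
  by_contra hv
  obtain ⟨u, hu, w, hw, huw⟩ := hconn L.toFinset
    ⟨y, List.mem_toFinset.2 (List.mem_of_mem_head? (by simp [hy]))⟩ ⟨v, by simpa using hv⟩
  rw [List.mem_toFinset] at hu hw
  obtain ⟨l₁, l₂, rfl⟩ := List.append_of_mem hu
  have hc := hL.1.1
  rw [List.isChain_append] at hc
  have hperm : (u :: l₂ ++ l₁).Perm (l₁ ++ u :: l₂) := List.perm_append_comm
  have := hL.2 (w :: (u :: l₂ ++ l₁)) ⟨?_, ?_⟩
  · simp at this
    omega
  · rw [List.cons_append, List.isChain_cons_cons, ← List.cons_append, List.isChain_append]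
    refine ⟨huw.symm, hc.2.1, hc.1, fun a ha b hb => ?_⟩
    have ha' : a = z := by
      rw [List.getLast?_append] at hz
      rw [Option.mem_def] at ha
      rw [ha] at hz
      simpa using hz
    have hb' : b = y := by
      rw [List.head?_append] at hy
      rw [Option.mem_def] at hb
      rw [hb] at hy
      simpa using hy
    rw [ha', hb']
    exact hadj
  · rw [List.nodup_cons]
    exact ⟨fun h => hw (hperm.subset h), hperm.nodup_iff.2 hL.1.2⟩

omit [Fintype V] in
lemma IsLongest.exists_hamiltonian {m : ℕ} (hJ : Joined G m) {M N : List V}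
    (hL : IsLongest G (M ++ N)) (hlen : 3 ≤ (M ++ N).length)
    (hconn : ∀ W : Finset V, W.Nonempty → (∃ v, v ∉ W) → ∃ u ∈ W, ∃ v, v ∉ W ∧ G.Adj u v)
    {X Y : Finset V} (hX : ∀ x ∈ X, ∃ t, Head G M t x) (hY : ∀ y ∈ Y, ∃ t, Head G N.reverse t y)
    (hXm : m ≤ X.card) (hYm : m ≤ Y.card) :
    ∃ (v : V) (c : G.Walk v v), c.IsHamiltonianCycle := by
  have hnd := List.nodup_append.1 hL.1.2
  have hch := List.isChain_append.1 hL.1.1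
  have hdisj : Disjoint X Y := by
    rw [Finset.disjoint_left]
    intro x hx hy
    obtain ⟨t, l, h⟩ := hX x hx
    obtain ⟨t', l', h'⟩ := hY x hy
    exact hnd.2.2 x (h.perm.subset (by simp)) x (by simpa using h'.perm.subset (by simp)) rfl
  obtain ⟨x, hx, y, hy, hxy⟩ := hJ X Y hdisj hXm hYm
  obtain ⟨t, l, h⟩ := hX x hx
  obtain ⟨t', l', h'⟩ := hY y hy
  have hM := h.isListPath ⟨hch.1, hnd.1⟩
  have hN := (h'.isListPath (IsListPath.reverse ⟨hch.2.1, hnd.2.1⟩)).reverse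
  have hperm : ((x :: l) ++ (y :: l').reverse).Perm (M ++ N) :=
    h.perm.append ((List.reverse_perm _).trans (h'.perm.trans (List.reverse_perm _)))
  have hpath : IsListPath G ((x :: l) ++ (y :: l').reverse) := by
    refine ⟨List.isChain_append.2 ⟨hM.1, hN.1, ?_⟩, hperm.nodup_iff.2 hL.1.2⟩
    rw [h.getLast?_eq, List.head?_reverse, h'.getLast?_eq, List.getLast?_reverse]
    exact hch.2.2
  have hlong : IsLongest G ((x :: l) ++ (y :: l').reverse) :=
    ⟨hpath, fun L' hL' => hperm.length_eq ▸ hL.2 L' hL'⟩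
  have h1 : ((x :: l) ++ (y :: l').reverse).head? = some x := by simp
  have h2 : ((x :: l) ++ (y :: l').reverse).getLast? = some y := by
    rw [List.getLast?_append]; simp
  exact exists_isHamiltonianCycle_of_isListPath hpath
    (hlong.mem_of_closed h1 h2 hxy.symm hconn) (hperm.length_eq ▸ hlen) h1 h2 hxy.symm

end Fin
end Expander

namespace Expander

variable {V : Type*} {G : SimpleGraph V} [DecidableEq V]

/-- The block `j` of length `s` of `P` is traversed unchanged, up to direction, by `L`. -/
def Unbroken (P L : List V) (s j : ℕ) : Prop :=
  ∀ i, i / s = j → (i + 1) / s = j → ∀ h : i + 1 < P.length, Consec L (P[i]'(by omega)) P[i + 1]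

open Classical in
omit [DecidableEq V] in
lemma card_not_unbroken_le {P L : List V} (hP : P.Nodup) (s : ℕ) {F : Finset (Sym2 V)}
    (hF : ∀ u v, Consec P u v → Consec L u v ∨ s(u, v) ∈ F) (K : Finset ℕ) :
    (K.filter fun j => ¬ Unbroken P L s j).card ≤ F.card := by
  have hex : ∀ j ∈ K.filter fun j => ¬ Unbroken P L s j, ∃ e ∈ F, ∃ i, i / s = j ∧
      ∃ h : i + 1 < P.length, e = s(P[i]'(by omega), P[i + 1]) := by
    intro j hj
    simp only [Finset.mem_filter, Unbroken, not_forall] at hj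
    obtain ⟨-, i, hi, -, h, hc⟩ := hj
    exact ⟨_, (hF _ _ (consec_getElem h)).resolve_left hc, i, hi, h, rfl⟩
  refine Finset.card_le_card_of_forall_subsingleton
    (fun j e => ∃ i, i / s = j ∧ ∃ h : i + 1 < P.length, e = s(P[i]'(by omega), P[i + 1]))
    hex ?_
  rintro e - j ⟨-, i, rfl, h, rfl⟩ j' ⟨-, i', rfl, h', he⟩
  simp only [Sym2.eq_iff, hP.getElem_inj_iff] at he
  rcases he with he | he
  · simp only [he.1]
  · omega

lemma exists_split {P L : List V} (hP : P.Nodup) (hLP : L.Perm P) {s q : ℕ} (hs : 0 < s)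
    (hq : 0 < q) {U : Finset ℕ} (hU : ∀ j ∈ U, Unbroken P L s j)
    (hlen : ∀ j ∈ U, (j + 1) * s ≤ P.length) (hcard : 2 * q ≤ U.card) :
    ∃ M N, L = M ++ N ∧ ∃ J₁ ⊆ U, ∃ J₂ ⊆ U, J₁.card = q ∧ J₂.card = q ∧
      (∀ v ∈ P, P.idxOf v / s ∈ J₁ → v ∈ M) ∧ (∀ v ∈ P, P.idxOf v / s ∈ J₂ → v ∈ N) := by
  classical
  have hL : L.Nodup := hLP.nodup_iff.2 hP
  set f : ℕ → Finset ℕ := fun t =>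
    U.filter fun j => ∀ v ∈ P, P.idxOf v / s = j → v ∈ L.take t with hf
  have hex : ∃ t, q ≤ (f t).card := by
    refine ⟨L.length, ?_⟩
    have : f L.length = U := by
      rw [hf]
      refine Finset.filter_true_of_mem fun j _ v hv _ => ?_
      rw [List.take_length]
      exact hLP.mem_iff.2 hv
    rw [this]; omega
  have hblock : ∀ j ∈ U, ∀ k < s, ∃ h : j * s + k < P.length, P.idxOf P[j * s + k] / s = j := by
    intro j hj k hk
    have h1 := hlen j hj
    rw [add_mul, one_mul] at h1
    refine ⟨by omega, ?_⟩
    rw [hP.idxOf_getElem, mul_comm, Nat.mul_add_div hs, Nat.div_eq_of_lt hk, add_zero]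
  obtain ⟨t, ht, hmin⟩ : ∃ t, q ≤ (f (t + 1)).card ∧ (f t).card < q := by
    have hspec := Nat.find_spec hex
    have hmin := fun k => Nat.find_min (m := k) hex
    rcases h : Nat.find hex with _ | t
    · exfalso
      rw [h] at hspec
      obtain ⟨j, hj⟩ := Finset.card_pos.1 (hq.trans_le hspec)
      rw [hf, Finset.mem_filter] at hj
      obtain ⟨h, hb⟩ := hblock j hj.1 0 hs
      simpa using hj.2 _ (List.getElem_mem h) hb
    · rw [h] at hspec hmin
      exact ⟨t, hspec, not_le.1 (hmin t (Nat.lt_succ_self t))⟩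
  have htL : t < L.length := by
    by_contra! h
    have : f (t + 1) = f t := by
      simp only [hf, List.take_of_length_le h, List.take_of_length_le (h.trans (Nat.le_succ t))]
    rw [this] at ht
    omega
  have htake : L.take (t + 1) = L.take t ++ [L[t]] := by simp
  set j₀ := P.idxOf L[t] / s with hj₀
  have hsub : ∀ j ∈ f (t + 1), j ≠ j₀ → j ∈ f t := by
    intro j hj hne
    rw [hf, Finset.mem_filter] at hj ⊢
    refine ⟨hj.1, fun v hv hvj => ?_⟩
    have := hj.2 v hv hvj
    rw [htake, List.mem_append, List.mem_singleton] at this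
    rcases this with h | h
    · exact h
    · exact absurd (by rw [hj₀, ← h, hvj]) hne
  have hj₀mem : j₀ ∈ f (t + 1) := by
    by_contra h
    have : f (t + 1) ⊆ f t := fun j hj => hsub j hj (fun e => h (e ▸ hj))
    have := Finset.card_le_card this
    omega
  have hcardf : (f (t + 1)).card = q := by
    have h1 : f (t + 1) ⊆ insert j₀ (f t) := fun j hj => by
      by_cases h : j = j₀
      · simp [h]
      · exact Finset.mem_insert_of_mem (hsub j hj h)
    have := (Finset.card_le_card h1).trans (Finset.card_insert_le _ _)
    omega
  have hsd := Finset.le_card_sdiff (f (t + 1)) U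
  obtain ⟨J₂, hJ₂, hJ₂c⟩ := Finset.exists_subset_card_eq
    (show q ≤ (U \ f (t + 1)).card by omega)
  refine ⟨L.take (t + 1), L.drop (t + 1), (List.take_append_drop _ _).symm, f (t + 1),
    Finset.filter_subset _ _, J₂, hJ₂.trans Finset.sdiff_subset, hcardf, hJ₂c, ?_, ?_⟩
  · intro v hv hvj
    exact (Finset.mem_filter.1 hvj).2 v hv rfl
  · intro v hv hvj
    obtain ⟨hjU, hjf⟩ := Finset.mem_sdiff.1 (hJ₂ hvj)
    set j := P.idxOf v / s with hj
    have hjne : j ≠ j₀ := fun h => hjf (h ▸ hj₀mem)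
    have hdis : ∀ w ∈ L.drop (t + 1), w ∉ L.take (t + 1) := fun w hw hw' =>
      List.disjoint_take_drop hL le_rfl hw' hw
    have hlast : (L.take (t + 1)).getLast? = some L[t] := by
      rw [htake, List.getLast?_append]; simp
    have hstep : ∀ k, k + 1 < s → ∀ (h : j * s + (k + 1) < P.length),
        (P[j * s + k]'(by omega) ∈ L.take (t + 1) ↔ P[j * s + (k + 1)] ∈ L.take (t + 1)) := by
      intro k hk h
      obtain ⟨h1, h1'⟩ := hblock j hjU k (by omega)
      obtain ⟨h2, h2'⟩ := hblock j hjU (k + 1) hk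
      have e1 := h1'
      have e2 := h2'
      rw [hP.idxOf_getElem] at e1 e2
      have hc := hU j hjU (j * s + k) e1 e2 h
      rw [← List.take_append_drop (t + 1) L] at hc
      rcases hc.of_append with hc | hc | hc | hc
      · exact ⟨fun _ => hc.mem_right, fun _ => hc.mem_left⟩
      · exact ⟨fun h' => absurd h' (hdis _ hc.mem_left),
          fun h' => absurd h' (hdis _ hc.mem_right)⟩
      · rw [hlast, Option.some_inj] at hc
        exact absurd (by rw [hj₀, hc.1, h1']) hjne
      · rw [hlast, Option.some_inj] at hc
        exact absurd (by rw [hj₀, hc.1]; exact h2'.symm) hjne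
    have hall : ∀ k, k < s → ∀ (h : j * s + k < P.length),
        (P[j * s + k] ∈ L.take (t + 1) ↔ P[j * s]'(by omega) ∈ L.take (t + 1)) := by
      intro k
      induction k with
      | zero => intro _ _; simp
      | succ k ih => intro hk h; rw [← hstep k hk h]; exact ih (by omega) (by omega)
    have hform : ∀ w ∈ P, P.idxOf w / s = j → (w ∈ L.take (t + 1) ↔
        P[j * s]'(hblock j hjU 0 hs).1 ∈ L.take (t + 1)) := by
      intro w hw hwj
      have hlt := List.idxOf_lt_length_iff.2 hw
      have hdm : j * s + P.idxOf w % s = P.idxOf w := by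
        rw [← hwj, mul_comm]; exact Nat.div_add_mod _ _
      have := hall (P.idxOf w % s) (Nat.mod_lt _ hs) (by omega)
      simp only [hdm, List.getElem_idxOf] at this
      exact this
    have hnot : v ∉ L.take (t + 1) := by
      intro hvM
      refine hjf (Finset.mem_filter.2 ⟨hjU, fun w hw hwj => ?_⟩)
      exact (hform w hw hwj).2 ((hform v hv rfl).1 hvM)
    have hvL : v ∈ L.take (t + 1) ++ L.drop (t + 1) := by
      rw [List.take_append_drop]; exact hLP.mem_iff.2 hv
    exact (List.mem_append.1 hvL).resolve_left hnot

variable [Fintype V]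

/-- The vertices of `P` in the interior of the blocks of length `s` with index in `J`. -/
def blockInner (P : List V) (s : ℕ) (J : Finset ℕ) : Finset V :=
  Finset.univ.filter fun v => P.idxOf v + 1 < P.length ∧ P.idxOf v / s ∈ J ∧
    0 < P.idxOf v % s ∧ P.idxOf v % s + 1 < s

lemma inner_of_mem_blockInner {P : List V} {s : ℕ} {J : Finset ℕ} {v : V}
    (h : v ∈ blockInner P s J) : Inner P v := by
  simp only [blockInner, Finset.mem_filter, Finset.mem_univ, true_and] at h
  refine ⟨Nat.pos_of_ne_zero fun h0 => ?_, h.1⟩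
  have := h.2.2.1
  simp [h0] at this

lemma card_blockInner {P : List V} (hP : P.Nodup) {s : ℕ} {J : Finset ℕ}
    (hlen : ∀ j ∈ J, (j + 1) * s ≤ P.length) :
    J.card * (s - 2) ≤ (blockInner P s J).card := by
  have : J.card * (s - 2) = (J ×ˢ Finset.range (s - 2)).card := by simp
  rw [this]
  refine Finset.card_le_card_of_surjOn
    (fun v => (P.idxOf v / s, P.idxOf v % s - 1)) ?_
  rintro ⟨j, i⟩ hji
  simp only [Finset.coe_product, Set.mem_prod, Finset.mem_coe, Finset.mem_range] at hji
  have h1 := hlen j hji.1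
  rw [add_mul, one_mul] at h1
  have h2 : (j * s + (i + 1)) / s = j := by
    rw [mul_comm, Nat.mul_add_div (by omega), Nat.div_eq_of_lt (by omega), add_zero]
  have h3 : (j * s + (i + 1)) % s = i + 1 := by
    rw [mul_comm, Nat.mul_add_mod, Nat.mod_eq_of_lt (by omega)]
  refine ⟨P[j * s + (i + 1)]'(by omega), ?_, ?_⟩
  · simp only [blockInner, Finset.coe_filter, Finset.mem_univ, true_and, Set.mem_ofPred_eq,
      hP.idxOf_getElem, h2, h3]
    exact ⟨by omega, hji.1, by omega, by omega⟩
  · simp [hP.idxOf_getElem, h2, h3]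

lemma consec_of_unbroken {P L : List V} (hP : P.Nodup) {s : ℕ} {J : Finset ℕ}
    (hU : ∀ j ∈ J, Unbroken P L s j) {v : V} (h : v ∈ blockInner P s J) :
    Consec L v (prv P v) ∧ Consec L v (nxt P v) ∧
      P.idxOf (prv P v) / s ∈ J ∧ P.idxOf (nxt P v) / s ∈ J := by
  have hi := inner_of_mem_blockInner h
  simp only [blockInner, Finset.mem_filter, Finset.mem_univ, true_and] at h
  obtain ⟨h1, h2, h3, h4⟩ := h
  have hpos := hi.1
  set i := P.idxOf v with hidx
  have hs : 0 < s := by omega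
  have hdm := Nat.div_add_mod i s
  have e1 : (i + 1) / s = i / s := by
    conv_lhs => rw [← hdm, add_assoc, Nat.mul_add_div hs, Nat.div_eq_of_lt h4, add_zero]
  have e2 : (i - 1) / s = i / s := by
    have h5 : i - 1 = s * (i / s) + (i % s - 1) := by omega
    conv_lhs => rw [h5, Nat.mul_add_div hs,
      Nat.div_eq_of_lt (show i % s - 1 < s by omega), add_zero]
  have hv : P[i]'(by omega) = v := List.getElem_idxOf _
  refine ⟨?_, ?_, ?_, ?_⟩
  · have := hU _ h2 (i - 1) e2 (by rw [Nat.sub_add_cancel hpos]) (by omega)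
    simp only [Nat.sub_add_cancel hpos, hv] at this
    rw [hi.prv_eq]
    exact this.symm
  · have := hU _ h2 i rfl e1 h1
    rw [hv] at this
    rw [hi.nxt_eq]
    exact this
  · rw [hi.prv_eq, hP.idxOf_getElem, ← hidx, e2]; exact h2
  · rw [hi.nxt_eq, hP.idxOf_getElem, ← hidx, e1]; exact h2

lemma le_card_of_head {P M : List V} (hP : P.Nodup) (hM : M.Nodup) {m s : ℕ} {J : Finset ℕ}
    {D : Finset V} (hD : ∀ T, RotClosed G (blockInner P s J) (prv P) (nxt P) T →
      ∀ v ∈ T, v ∉ D → m ≤ T.card)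
    (hc : ∀ v ∈ blockInner P s J, Consec M v (prv P v) ∧ Consec M v (nxt P v))
    {b : V} (hb : M.head? = some b) (hbD : b ∉ D) :
    ∃ X : Finset V, (∀ x ∈ X, ∃ t, Head G M t x) ∧ m ≤ X.card := by
  classical
  refine ⟨Finset.univ.filter fun x => ∃ t, Head G M t x, by simp, hD _ ?_ b ?_ hbD⟩
  · rintro x hx ⟨y, hy, hyx⟩
    simp only [Finset.mem_filter, Finset.mem_univ, true_and] at hy ⊢
    obtain ⟨t, l, hl⟩ := hy
    have hcx := hc x hx
    rcases hl.posa hM (hl.perm.mem_iff.2 hcx.1.mem_left) hyx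
      ((inner_of_mem_blockInner hx).prv_ne_nxt hP) hcx.1 hcx.2 with h | h | h
    · exact .inl ⟨_, h⟩
    · exact .inr (.inl ⟨_, h⟩)
    · exact .inr (.inr ⟨_, h⟩)
  · obtain ⟨l, rfl⟩ := List.head?_eq_some_iff.1 hb
    simpa using ⟨0, l, Rot.refl⟩

lemma IsLongest.le_card_heads {P : List V} (hP : IsLongest G P) (hne : P ≠ []) {m B ρ : ℕ}
    (hexp : ∀ X : Finset V, X.Nonempty → X.card < m →
      (3 * B + 1) * X.card ≤ (closedNbr G X).card) (hρ : m ≤ B ^ ρ) :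
    m ≤ (heads G P ρ).card := by
  have h : ∀ t, (heads G P t).Nonempty ∧ (B ^ t ≤ (heads G P t).card ∨ m ≤ (heads G P t).card) := by
    intro t
    induction t with
    | zero =>
      obtain ⟨y, l, rfl⟩ := List.exists_cons_of_ne_nil hne
      have : (heads G (y :: l) 0).Nonempty := ⟨y, mem_heads.2 ⟨l, Rot.refl⟩⟩
      exact ⟨this, .inl (by simpa using this.card_pos)⟩
    | succ t ih =>
      have hmono : heads G P t ⊆ heads G P (t + 1) := fun v hv => by
        rw [mem_heads] at hv ⊢
        exact hv.mono
      refine ⟨ih.1.mono hmono, ?_⟩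
      by_cases hm : m ≤ (heads G P t).card
      · exact .inr (hm.trans (Finset.card_le_card hmono))
      · left
        have h1 := hexp _ ih.1 (not_le.1 hm)
        have h2 := (hP.closedNbr_heads t).2
        have h3 := ih.1.card_pos
        have h4 := Nat.mul_le_mul_left B (ih.2.resolve_right hm)
        rw [pow_succ, mul_comm]
        rw [add_mul, one_mul, mul_assoc] at h1
        omega
  rcases (h ρ).2 with h | h
  · exact hρ.trans h
  · exact h

end Expander

namespace Expander

/-- The `γ`-th interval of `r` consecutive natural numbers. -/
def group (r γ : ℕ) : Finset ℕ := Finset.Ico (γ * r) ((γ + 1) * r)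

lemma card_group (r γ : ℕ) : (group r γ).card = r := by
  rw [group, Nat.card_Ico, add_mul, one_mul, Nat.add_sub_cancel_left]

lemma div_of_mem_group {r γ j : ℕ} (hj : j ∈ group r γ) : j / r = γ := by
  rw [group, Finset.mem_Ico] at hj
  exact Nat.div_eq_of_lt_le hj.1 hj.2

lemma lt_of_mem_group {r γ j K : ℕ} (hγ : γ < K) (hj : j ∈ group r γ) : j < K * r := by
  rw [group, Finset.mem_Ico] at hj
  exact hj.2.trans_le (Nat.mul_le_mul_right r hγ)

lemma card_groups_mul_le (p : ℕ → Prop) [DecidablePred p] (r t K : ℕ) :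
    ((Finset.range K).filter fun γ => t ≤ ((group r γ).filter p).card).card * t ≤
      ((Finset.range (K * r)).filter p).card := by
  rw [Finset.card_eq_sum_card_fiberwise (s := (Finset.range (K * r)).filter p)
    (f := fun j => j / r) (t := Finset.range K)]
  · rw [← smul_eq_mul]
    refine (Finset.card_nsmul_le_sum _ (fun γ => ((group r γ).filter p).card) _
      fun γ hγ => (Finset.mem_filter.1 hγ).2).trans ?_
    refine (Finset.sum_le_sum_of_subset (Finset.filter_subset _ _)).trans ?_
    refine Finset.sum_le_sum fun γ hγ => Finset.card_le_card fun j hj => ?_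
    rw [Finset.mem_filter] at hj
    simp only [Finset.mem_filter, Finset.mem_range]
    exact ⟨⟨lt_of_mem_group (Finset.mem_range.1 hγ) hj.1, hj.2⟩, div_of_mem_group hj.1⟩
  · intro j hj
    simp only [Finset.coe_filter, Finset.mem_range, Set.mem_ofPred_eq] at hj
    simp only [Finset.coe_range, Set.mem_Iio]
    rcases Nat.eq_zero_or_pos r with rfl | hr
    · simp at hj
    · exact (Nat.div_lt_iff_lt_mul hr).2 hj.1

variable {V : Type*} {G : SimpleGraph V} [DecidableEq V] [Fintype V]

lemma card_heavy_le (E : ℕ → Finset V) {c K : ℕ} (hK : 0 < K) (hE : ∀ γ < K, (E γ).card ≤ c) :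
    (Finset.univ.filter fun v => K ≤ 4 * ((Finset.range K).filter fun γ => v ∈ E γ).card).card ≤
      4 * c := by
  classical
  set S := Finset.univ.filter fun v => K ≤ 4 * ((Finset.range K).filter fun γ => v ∈ E γ).card
    with hS
  have h := Finset.sum_card_bipartiteAbove_eq_sum_card_bipartiteBelow (s := S)
    (t := Finset.range K) (fun v γ => v ∈ E γ)
  have h1 : ∑ γ ∈ Finset.range K, (S.bipartiteBelow (fun v γ => v ∈ E γ) γ).card ≤ K * c := by
    refine (Finset.sum_le_card_nsmul _ _ c fun γ hγ => ?_).trans (by simp)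
    refine (Finset.card_le_card fun v hv => ?_).trans (hE γ (Finset.mem_range.1 hγ))
    exact (Finset.mem_filter.1 hv).2
  have h2 : S.card * K ≤
      ∑ v ∈ S, 4 * ((Finset.range K).bipartiteAbove (fun v γ => v ∈ E γ) v).card := by
    rw [← smul_eq_mul]
    exact Finset.card_nsmul_le_sum _ _ _ fun v hv => (Finset.mem_filter.1 hv).2
  rw [← Finset.mul_sum, h] at h2
  have h3 : S.card * K ≤ (4 * c) * K := by nlinarith
  exact Nat.le_of_mul_le_mul_right h3 hK

lemma exists_exceptional_groups {m : ℕ} (hm : 0 < m) (hJ : Joined G m) {P : List V}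
    (hP : P.Nodup) {s q K : ℕ} (hK : 0 < K) (hs : 7 * m ≤ q * (s - 2))
    (hlen : K * (4 * q) * s ≤ P.length) :
    ∃ (E : ℕ → Finset V) (S : Finset V), S.card ≤ 8 * 2 ^ (4 * q) * m ∧
      (∀ v, v ∉ S → 4 * ((Finset.range K).filter fun γ => v ∈ E γ).card < K) ∧
      ∀ γ < K, ∀ J ⊆ group (4 * q) γ, J.card = q →
        ∀ T, RotClosed G (blockInner P s J) (prv P) (nxt P) T →
          ∀ v ∈ T, v ∉ E γ → m ≤ T.card := by
  classical
  have hex : ∀ J : Finset ℕ, ∃ D : Finset V, D.card ≤ 2 * m ∧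
      ((∀ j ∈ J, j < K * (4 * q)) → J.card = q →
        ∀ T, RotClosed G (blockInner P s J) (prv P) (nxt P) T → ∀ v ∈ T, v ∉ D → m ≤ T.card) := by
    intro J
    by_cases h : (∀ j ∈ J, j < K * (4 * q)) ∧ J.card = q
    · have hb : ∀ j ∈ J, (j + 1) * s ≤ P.length := fun j hj =>
        (Nat.mul_le_mul_right s (h.1 j hj)).trans hlen
      obtain ⟨D, hD, hD'⟩ := exists_exceptional hm hJ (I := blockInner P s J)
        ((prv_injOn hP).mono fun v hv => inner_of_mem_blockInner hv)
        ((nxt_injOn hP).mono fun v hv => inner_of_mem_blockInner hv)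
        (hs.trans (h.2 ▸ card_blockInner hP hb))
      exact ⟨D, hD.le, fun _ _ => hD'⟩
    · exact ⟨∅, by simp, fun h1 h2 => absurd ⟨h1, h2⟩ h⟩
  choose D hD hD' using hex
  set E : ℕ → Finset V := fun γ => ((group (4 * q) γ).powersetCard q).biUnion D with hEdef
  have hE : ∀ γ < K, (E γ).card ≤ 2 ^ (4 * q) * (2 * m) := by
    intro γ _
    refine (Finset.card_biUnion_le_card_mul _ _ (2 * m) fun J _ => hD J).trans ?_
    refine Nat.mul_le_mul_right _ ?_
    rw [Finset.card_powersetCard, card_group]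
    exact Nat.choose_le_two_pow _ _
  refine ⟨E, _, (card_heavy_le E hK hE).trans (le_of_eq (by ring)), ?_, ?_⟩
  · intro v hv
    simpa using hv
  · intro γ hγ J hJs hJc T hT v hv hvE
    refine hD' J (fun j hj => lt_of_mem_group hγ (hJs hj)) hJc T hT v hv fun hvD => hvE ?_
    exact Finset.mem_biUnion.2 ⟨J, Finset.mem_powersetCard.2 ⟨hJs, hJc⟩, hvD⟩

omit [Fintype V] in
lemma exists_group {P L : List V} (hP : P.Nodup) {s q K ρ : ℕ} {F : Finset (Sym2 V)}
    (hF : ∀ u v, Consec P u v → Consec L u v ∨ s(u, v) ∈ F) (hFc : F.card ≤ 2 * ρ)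
    (hK : 4 * ρ ≤ K * (2 * q + 1)) {E : ℕ → Finset V} {a b : V}
    (ha : 4 * ((Finset.range K).filter fun γ => a ∈ E γ).card < K)
    (hb : 4 * ((Finset.range K).filter fun γ => b ∈ E γ).card < K) :
    ∃ γ < K, a ∉ E γ ∧ b ∉ E γ ∧
      ∃ U ⊆ group (4 * q) γ, 2 * q ≤ U.card ∧ ∀ j ∈ U, Unbroken P L s j := by
  classical
  obtain ⟨A, hA⟩ : ∃ A, A = (Finset.range K).filter fun γ => a ∈ E γ := ⟨_, rfl⟩
  obtain ⟨B, hB⟩ : ∃ B, B = (Finset.range K).filter fun γ => b ∈ E γ := ⟨_, rfl⟩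
  obtain ⟨C, hC⟩ : ∃ C, C = (Finset.range K).filter fun γ =>
    2 * q + 1 ≤ ((group (4 * q) γ).filter fun j => ¬ Unbroken P L s j).card := ⟨_, rfl⟩
  rw [← hA] at ha
  rw [← hB] at hb
  have hCc : C.card * (2 * q + 1) ≤ 2 * ρ := by
    have h1 := card_groups_mul_le (fun j => ¬ Unbroken P L s j) (4 * q) (2 * q + 1) K
    have h2 := card_not_unbroken_le hP s hF (Finset.range (K * (4 * q)))
    rw [hC]
    exact (h1.trans h2).trans hFc
  have hC2 : 2 * C.card ≤ K := by
    refine Nat.le_of_mul_le_mul_right (c := 2 * q + 1) ?_ (by omega)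
    rw [mul_assoc]
    omega
  have hU : (A ∪ B ∪ C).card < (Finset.range K).card := by
    have h1 := Finset.card_union_le (A ∪ B) C
    have h2 := Finset.card_union_le A B
    rw [Finset.card_range]
    omega
  obtain ⟨γ, hγ, hγ'⟩ := Finset.exists_mem_notMem_of_card_lt_card hU
  simp only [Finset.mem_union, hA, hB, hC, Finset.mem_filter, not_or, not_and, hγ,
    true_implies, not_le] at hγ'
  refine ⟨γ, Finset.mem_range.1 hγ, hγ'.1.1, hγ'.1.2, (group (4 * q) γ).filter fun j =>
    Unbroken P L s j, Finset.filter_subset _ _, ?_, fun j hj => (Finset.mem_filter.1 hj).2⟩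
  have h1 := Finset.card_filter_add_card_filter_not (s := group (4 * q) γ)
    (fun j => Unbroken P L s j)
  rw [card_group] at h1
  have := hγ'.2
  omega

lemma exists_nonheavy_end {P : List V} (hP : IsLongest G P) (hne : P ≠ []) {m B ρ c : ℕ}
    (hJ : Joined G m)
    (hexp : ∀ X : Finset V, X.Nonempty → X.card < m →
      (3 * B + 1) * X.card ≤ (closedNbr G X).card) (hρ : m ≤ B ^ ρ)
    {S : Finset V} (hS : S.card ≤ c) (hc : 3 * c + m + 1 < Fintype.card V) :
    ∃ a l, a ∉ S ∧ Rot G P (ρ + 1) (a :: l) := by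
  have h1 := hJ.card_le (hP.le_card_heads hne hexp hρ)
  have h2 := (hP.closedNbr_heads ρ).2
  obtain ⟨a, ha, haS⟩ := Finset.exists_mem_notMem_of_card_lt_card
    (show S.card < (heads G P (ρ + 1)).card by omega)
  obtain ⟨l, hl⟩ := mem_heads.1 ha
  exact ⟨a, l, haS, hl⟩

theorem exists_isHamiltonianCycle {m B ρ q s K : ℕ} (hm : 0 < m) (hq : 0 < q) (hK : 0 < K)
    (hJ : Joined G m)
    (hexp : ∀ X : Finset V, X.Nonempty → X.card < m →
      (3 * B + 1) * X.card ≤ (closedNbr G X).card)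
    (hconn : ∀ W : Finset V, W.Nonempty → (∃ v, v ∉ W) → ∃ u ∈ W, ∃ v, v ∉ W ∧ G.Adj u v)
    (hρ : m ≤ B ^ ρ) (hKρ : 4 * (ρ + 1) ≤ K * (2 * q + 1))
    (hcard : 3 * (8 * 2 ^ (4 * q) * m) + m + 1 < Fintype.card V)
    (hlen : K * (4 * q) * s + m ≤ Fintype.card V) (hs : 7 * m ≤ q * (s - 2)) :
    ∃ (v : V) (c : G.Walk v v), c.IsHamiltonianCycle := by
  classical
  obtain ⟨P, hP⟩ := exists_isLongest G
  have hPn := hP.1.2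
  have hne : P ≠ [] := by
    rintro rfl
    obtain ⟨v⟩ : Nonempty V := Fintype.card_pos_iff.1 (by omega)
    simpa using hP.2 [v] ⟨by simp, by simp⟩
  have hPlen : Fintype.card V ≤ m + P.length :=
    (hJ.card_le (hP.le_card_heads hne hexp hρ)).trans
      (Nat.add_le_add_left (hP.closedNbr_heads ρ).1 m)
  have hlenP : K * (4 * q) * s ≤ P.length := by omega
  have hs3 : 3 ≤ s := by
    by_contra! h
    rw [show s - 2 = 0 by omega] at hs
    omega
  obtain ⟨E, S, hS, hlight, hE⟩ := exists_exceptional_groups hm hJ hPn hK hs hlenP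
  obtain ⟨a, l, haS, hl⟩ := exists_nonheavy_end hP hne hJ hexp hρ hS hcard
  obtain ⟨b, l', hbS, hl'⟩ := exists_nonheavy_end (hP.rot hl).reverse (by simp) hJ hexp hρ hS hcard
  obtain ⟨F₁, hF₁c, hF₁⟩ := hl.exists_broken
  obtain ⟨F₂, hF₂c, hF₂⟩ := hl'.exists_broken
  have hF : ∀ u v, Consec P u v → Consec (b :: l') u v ∨ s(u, v) ∈ F₁ ∪ F₂ := by
    intro u v h
    rcases hF₁ u v h with h | h
    · rcases hF₂ u v h.reverse with h | h
      · exact .inl h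
      · exact .inr (Finset.mem_union_right _ h)
    · exact .inr (Finset.mem_union_left _ h)
  have hFc : (F₁ ∪ F₂).card ≤ 2 * (ρ + 1) := by
    have := Finset.card_union_le F₁ F₂
    omega
  obtain ⟨γ, hγ, haE, hbE, U, hU, hUc, hUb⟩ :=
    exists_group hPn hF hFc hKρ (hlight a haS) (hlight b hbS)
  have hL : IsLongest G (b :: l') := (hP.rot hl).reverse.rot hl'
  have hLP : (b :: l').Perm P := (hl'.perm.trans (List.reverse_perm _)).trans hl.perm
  have hlast : (b :: l').getLast? = some a := by
    rw [hl'.getLast?_eq]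
    simp
  obtain ⟨M, N, hMN, J₁, hJ₁, J₂, hJ₂, hJ₁c, hJ₂c, hM, hN⟩ := exists_split hPn hLP (by omega) hq hUb
    (fun j hj => (Nat.mul_le_mul_right s (lt_of_mem_group hγ (hU hj))).trans hlenP) hUc
  rw [hMN] at hL hLP hlast hUb
  have hnd := hL.1.2
  rw [List.nodup_append'] at hnd
  obtain ⟨hMn, hNn, hdis⟩ := hnd
  have hsplit : ∀ (J : Finset ℕ) (hJU : J ⊆ U) (v : V), v ∈ blockInner P s J →
      Consec (M ++ N) v (prv P v) ∧ Consec (M ++ N) v (nxt P v) ∧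
      v ∈ P ∧ P.idxOf v / s ∈ J ∧ prv P v ∈ P ∧ P.idxOf (prv P v) / s ∈ J ∧
      nxt P v ∈ P ∧ P.idxOf (nxt P v) / s ∈ J := by
    intro J hJU v hv
    obtain ⟨h1, h2, h3, h4⟩ := consec_of_unbroken hPn (fun j hj => hUb j (hJU hj)) hv
    exact ⟨h1, h2, (inner_of_mem_blockInner hv).mem, (Finset.mem_filter.1 hv).2.2.1,
      (inner_of_mem_blockInner hv).consec_prv.mem_right, h3,
      (inner_of_mem_blockInner hv).consec_nxt.mem_right, h4⟩
  have hleft : ∀ u v, u ∈ M → v ∈ M → Consec (M ++ N) u v → Consec M u v := by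
    intro u v hu hv h
    rcases h.of_append with h | h | h | h
    · exact h
    · exact (hdis hu h.mem_left).elim
    · exact (hdis hv (List.mem_of_mem_head? h.2)).elim
    · exact (hdis hu (List.mem_of_mem_head? h.2)).elim
  have hright : ∀ u v, u ∈ N → v ∈ N → Consec (M ++ N) u v → Consec N u v := by
    intro u v hu hv h
    rcases h.of_append with h | h | h | h
    · exact (hdis h.mem_left hu).elim
    · exact h
    · exact (hdis (List.mem_of_mem_getLast? h.1) hu).elim
    · exact (hdis (List.mem_of_mem_getLast? h.1) hv).elim
  have hcM : ∀ v ∈ blockInner P s J₁, Consec M v (prv P v) ∧ Consec M v (nxt P v) := by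
    intro v hv
    obtain ⟨h1, h2, h3, h4, h5, h6, h7, h8⟩ := hsplit J₁ hJ₁ v hv
    exact ⟨hleft _ _ (hM _ h3 h4) (hM _ h5 h6) h1, hleft _ _ (hM _ h3 h4) (hM _ h7 h8) h2⟩
  have hcN : ∀ v ∈ blockInner P s J₂,
      Consec N.reverse v (prv P v) ∧ Consec N.reverse v (nxt P v) := by
    intro v hv
    obtain ⟨h1, h2, h3, h4, h5, h6, h7, h8⟩ := hsplit J₂ hJ₂ v hv
    exact ⟨(hright _ _ (hN _ h3 h4) (hN _ h5 h6) h1).reverse,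
      (hright _ _ (hN _ h3 h4) (hN _ h7 h8) h2).reverse⟩
  have hne' : ∀ J : Finset ℕ, J ⊆ U → J.card = q → (blockInner P s J).Nonempty := by
    intro J hJU hJc
    have := card_blockInner (s := s) hPn (J := J) fun j hj =>
      (Nat.mul_le_mul_right s (lt_of_mem_group hγ (hU (hJU hj)))).trans hlenP
    rw [hJc] at this
    exact Finset.card_pos.1 (by omega)
  have hMne : M ≠ [] := by
    obtain ⟨v, hv⟩ := hne' J₁ hJ₁ hJ₁c
    exact List.ne_nil_of_mem (hcM v hv).1.mem_left
  have hNne : N ≠ [] := by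
    obtain ⟨v, hv⟩ := hne' J₂ hJ₂ hJ₂c
    exact List.ne_nil_of_mem (List.mem_reverse.1 (hcN v hv).1.mem_left)
  have hheadM : M.head? = some b := by
    have : (M ++ N).head? = some b := by rw [← hMN]; rfl
    rwa [List.head?_append_of_ne_nil _ hMne] at this
  have hheadN : N.reverse.head? = some a := by
    rw [List.getLast?_append_of_ne_nil _ hNne] at hlast
    rwa [List.head?_reverse]
  obtain ⟨X, hX, hXm⟩ := le_card_of_head hPn hMn (hE γ hγ J₁ (hJ₁.trans hU) hJ₁c) hcM hheadM hbE
  obtain ⟨Y, hY, hYm⟩ := le_card_of_head hPn (List.nodup_reverse.2 hNn)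
    (hE γ hγ J₂ (hJ₂.trans hU) hJ₂c) hcN hheadN haE
  refine IsLongest.exists_hamiltonian hJ hL ?_ hconn hX hY hXm hYm
  have h1 : K * (4 * q) * s ≥ 1 * s := Nat.mul_le_mul_right s (Nat.mul_pos hK (by omega))
  rw [hLP.length_eq]
  omega

end Expander

section IsExpander

open Expander

variable {V : Type*} [Fintype V] {G : SimpleGraph V} {n : ℕ} {d : ℝ}

lemma IsExpander.joined (h : IsExpander G n d) : Joined G ⌈(n : ℝ) / (2 * d)⌉₊ := by
  intro X Y hXY hX hY
  obtain ⟨X', hX', hXc⟩ := Finset.exists_subset_card_eq hX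
  obtain ⟨Y', hY', hYc⟩ := Finset.exists_subset_card_eq hY
  obtain ⟨x, hx, y, hy, hxy⟩ :=
    h.2.2 X' Y' (Finset.disjoint_of_subset_left hX' (Finset.disjoint_of_subset_right hY' hXY))
      hXc hYc
  exact ⟨x, hX' hx, y, hY' hy, hxy⟩

lemma IsExpander.mul_card_le_card_closedNbr [DecidableEq V] (h : IsExpander G n d)
    {X : Finset V} (hX : X.Nonempty) (hXm : X.card < ⌈(n : ℝ) / (2 * d)⌉₊) {k : ℕ} (hk : k ≤ d) :
    k * X.card ≤ (closedNbr G X).card := by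
  have h1 := h.2.1 X hX.card_pos hXm
  have h2 : (nbr G X).ncard ≤ (closedNbr G X).card := by
    rw [← Set.ncard_coe_finset]
    refine Set.ncard_le_ncard (fun v hv => ?_) (Finset.finite_toSet _)
    exact mem_closedNbr.2 (.inr hv.2)
  have h3 : (k : ℝ) * X.card ≤ (closedNbr G X).card :=
    (mul_le_mul_of_nonneg_right hk (Nat.cast_nonneg _)).trans (h1.trans (by exact_mod_cast h2))
  exact_mod_cast h3

lemma IsExpander.exists_adj_of_card_lt (h : IsExpander G n d) (hd : 0 < d)
    {X : Finset V} (hX : X.Nonempty) (hXm : X.card < ⌈(n : ℝ) / (2 * d)⌉₊) :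
    ∃ u ∈ X, ∃ v, v ∉ X ∧ G.Adj u v := by
  have h1 := h.2.1 X hX.card_pos hXm
  have h2 : (0 : ℝ) < (nbr G X).ncard :=
    (mul_pos hd (by exact_mod_cast hX.card_pos)).trans_le h1
  obtain ⟨v, hv, u, hu, huv⟩ := Set.nonempty_of_ncard_ne_zero
    (s := nbr G X) (by exact_mod_cast h2.ne')
  exact ⟨u, hu, v, hv, huv⟩

lemma IsExpander.exists_adj_compl (h : IsExpander G n d) (hd : 0 < d)
    (W : Finset V) (hW : W.Nonempty) (hW' : ∃ v, v ∉ W) : ∃ u ∈ W, ∃ v, v ∉ W ∧ G.Adj u v := by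
  classical
  rcases lt_or_ge W.card ⌈(n : ℝ) / (2 * d)⌉₊ with hlt | hge
  · exact h.exists_adj_of_card_lt hd hW hlt
  rcases lt_or_ge Wᶜ.card ⌈(n : ℝ) / (2 * d)⌉₊ with hlt | hge'
  · obtain ⟨v, hv⟩ := hW'
    obtain ⟨u, hu, w, hw, huw⟩ :=
      h.exists_adj_of_card_lt hd ⟨v, Finset.mem_compl.2 hv⟩ hlt
    exact ⟨w, by simpa using hw, u, Finset.mem_compl.1 hu, huw.symm⟩
  · obtain ⟨u, hu, v, hv, huv⟩ := h.joined W Wᶜ disjoint_compl_right hge hge'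
    exact ⟨u, hu, v, Finset.mem_compl.1 hv, huv⟩

theorem IsExpander.exists_isHamiltonianCycle [DecidableEq V] (h : IsExpander G n d) {ε : ℝ}
    (hε : 0 < ε) {q : ℕ} (hq : 476 ≤ q * ε) (hd : 100 * 2 ^ (4 * q) ≤ d)
    (hdq : (18 + 4 * q) * ε ≤ d) (hn : 2 * d ≤ n) (hn' : 204 * d ≤ n * ε)
    (hlog : 0 < Real.log (d / 6)) (hlog' : Real.log n ≤ 2 * d / ε * Real.log (d / 6)) :
    ∃ (v : V) (c : G.Walk v v), c.IsHamiltonianCycle := by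
  have hpow : (1 : ℝ) ≤ 2 ^ (4 * q) := one_le_pow₀ (by norm_num)
  have hd100 : 100 ≤ d := by linarith
  have hd0 : 0 < d := by linarith
  have hn0 : (0 : ℝ) < n := by linarith
  have hq0 : 0 < q := by
    rcases Nat.eq_zero_or_pos q with rfl | h
    · norm_num at hq
    · exact h
  set m := ⌈(n : ℝ) / (2 * d)⌉₊ with hm
  have hm0 : 0 < m := Nat.ceil_pos.2 (by positivity)
  have hmle : (m : ℝ) ≤ n / d := by
    have h1 : (m : ℝ) < n / (2 * d) + 1 := Nat.ceil_lt_add_one (by positivity)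
    have h2 : 1 ≤ (n : ℝ) / (2 * d) := by rw [le_div_iff₀ (by positivity)]; linarith
    have h3 : (n : ℝ) / d = n / (2 * d) + n / (2 * d) := by field_simp; norm_num
    linarith
  have hmd : (m : ℝ) * d ≤ n := by rwa [le_div_iff₀ hd0] at hmle
  set B := ⌊(d - 1) / 3⌋₊ with hB
  have hB1 : ((3 * B + 1 : ℕ) : ℝ) ≤ d := by
    have := Nat.floor_le (show 0 ≤ (d - 1) / 3 by linarith)
    push_cast
    linarith
  have hB2 : d / 6 ≤ B := by
    have := Nat.lt_floor_add_one ((d - 1) / 3)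
    linarith
  set ρ := ⌈Real.log n / Real.log (d / 6)⌉₊ with hρ
  have hρle : (ρ : ℝ) ≤ 2 * d / ε + 1 := by
    have h1 : (ρ : ℝ) < Real.log n / Real.log (d / 6) + 1 :=
      Nat.ceil_lt_add_one (div_nonneg (Real.log_nonneg (by linarith)) hlog.le)
    have h2 : Real.log n / Real.log (d / 6) ≤ 2 * d / ε := by rwa [div_le_iff₀ hlog]
    linarith
  have hmB : m ≤ B ^ ρ := by
    have h1 : Real.log n ≤ ρ * Real.log (d / 6) := by
      rw [← div_le_iff₀ hlog]
      exact Nat.le_ceil _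
    rw [← Real.log_pow, Real.log_le_log_iff hn0 (by positivity)] at h1
    have h2 : (m : ℝ) ≤ n := hmle.trans (div_le_self hn0.le (by linarith))
    have h3 : (m : ℝ) ≤ (B : ℝ) ^ ρ := h2.trans (h1.trans (by gcongr))
    exact_mod_cast h3
  set K := 4 * (ρ + 1) / (2 * q + 1) + 1 with hK
  have hKρ : 4 * (ρ + 1) ≤ K * (2 * q + 1) := by
    have := Nat.lt_div_mul_add (a := 4 * (ρ + 1)) (b := 2 * q + 1) (by omega)
    rw [hK, add_mul, one_mul]
    omega
  have hKle : K * (2 * q + 1) ≤ 4 * (ρ + 1) + (2 * q + 1) := by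
    rw [hK, add_mul, one_mul]
    exact Nat.add_le_add_right (Nat.div_mul_le_self _ _) _
  have hKd : (K * (4 * q) : ℝ) ≤ 17 * d / ε := by
    have h1 : (K * (2 * q + 1) : ℝ) ≤ 4 * (ρ + 1) + (2 * q + 1) := by exact_mod_cast hKle
    have h2 : (18 + 4 * q : ℝ) ≤ d / ε := by rwa [le_div_iff₀ hε]
    have h3 : 2 * d / ε = 2 * (d / ε) := by ring
    have h4 : 17 * d / ε = 17 * (d / ε) := by ring
    rw [h4]
    rw [h3] at hρle
    have h5 : (0 : ℝ) ≤ K := Nat.cast_nonneg _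
    linarith
  set s := ⌊n * ε / (34 * d)⌋₊ with hs
  have hsle : (s : ℝ) * (34 * d) ≤ n * ε := by
    rw [← le_div_iff₀ (by positivity)]
    exact Nat.floor_le (by positivity)
  have hs6 : 6 ≤ n * ε / (34 * d) := by rw [le_div_iff₀ (by positivity)]; linarith
  have hsge : n * ε / (34 * d) < s + 1 := Nat.lt_floor_add_one _
  have hs2 : 2 ≤ s := Nat.le_floor (by push_cast; linarith)
  have hcard := h.1
  refine Expander.exists_isHamiltonianCycle (m := m) (B := B) (ρ := ρ) (q := q) (s := s) (K := K)
    hm0 hq0 (Nat.succ_pos _) h.joined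
    (fun X hX hXm => h.mul_card_le_card_closedNbr hX hXm hB1) (h.exists_adj_compl hd0) hmB hKρ
    ?_ ?_ ?_
  · rw [hcard]
    have h1 : (m : ℝ) * (100 * 2 ^ (4 * q)) ≤ n :=
      (mul_le_mul_of_nonneg_left hd (Nat.cast_nonneg _)).trans hmd
    have h2 : (m : ℝ) * 1 ≤ m * 2 ^ (4 * q) :=
      mul_le_mul_of_nonneg_left hpow (Nat.cast_nonneg _)
    have h3 : (1 : ℝ) ≤ m := by exact_mod_cast hm0
    have h4 : ((3 * (8 * 2 ^ (4 * q) * m) + m + 1 : ℕ) : ℝ) < n := by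
      push_cast
      nlinarith
    exact_mod_cast h4
  · rw [hcard]
    have h1 : (K * (4 * q) * s : ℝ) ≤ 17 * d / ε * s :=
      mul_le_mul_of_nonneg_right hKd (Nat.cast_nonneg _)
    have h2 : 17 * d / ε * s ≤ n / 2 := by
      rw [div_mul_eq_mul_div, div_le_iff₀ hε]
      linarith
    have h3 : (m : ℝ) * 2 ≤ m * d := mul_le_mul_of_nonneg_left (by linarith) (Nat.cast_nonneg _)
    have h4 : ((K * (4 * q) * s + m : ℕ) : ℝ) ≤ n := by
      push_cast
      linarith
    exact_mod_cast h4
  · have h1 : n * ε / (68 * d) ≤ ((s - 2 : ℕ) : ℝ) := by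
      rw [Nat.cast_sub hs2]
      have : n * ε / (34 * d) = 2 * (n * ε / (68 * d)) := by field_simp; norm_num
      push_cast
      linarith
    have h2 : (q : ℝ) * (n * ε / (68 * d)) ≤ q * ((s - 2 : ℕ) : ℝ) :=
      mul_le_mul_of_nonneg_left h1 (Nat.cast_nonneg _)
    have h3 : 7 * ((n : ℝ) / d) ≤ q * (n * ε / (68 * d)) := by
      have e : q * (n * ε / (68 * d)) = (q * ε / 68) * (n / d) := by field_simp
      rw [e]
      exact mul_le_mul_of_nonneg_right (by linarith) (by positivity)
    have h4 : ((7 * m : ℕ) : ℝ) ≤ ((q * (s - 2) : ℕ) : ℝ) := by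
      push_cast
      linarith
    exact_mod_cast h4

end IsExpander

open Filter in
lemma Expander.eventually_log_div_log_log {ε : ℝ} (hε : 0 < ε) (C : ℝ) :
    ∀ᶠ n : ℕ in atTop, C ≤ ε * Real.log n / Real.log (Real.log n) ∧
      C * (ε * Real.log n / Real.log (Real.log n)) ≤ n ∧
      0 < Real.log (ε * Real.log n / Real.log (Real.log n) / 6) ∧
      Real.log n ≤ 2 * (ε * Real.log n / Real.log (Real.log n)) / ε *
        Real.log (ε * Real.log n / Real.log (Real.log n) / 6) := by
  have hl : Tendsto (fun n : ℕ => Real.log n) atTop atTop :=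
    Real.tendsto_log_atTop.comp tendsto_natCast_atTop_atTop
  have h1 : ∀ᶠ x : ℝ in atTop, Real.log x ≤ ε / 6 * x ^ (1 / 2 : ℝ) := by
    filter_upwards [(isLittleO_log_rpow_atTop (show (0 : ℝ) < 1 / 2 by norm_num)).def
      (show 0 < ε / 6 by positivity), eventually_ge_atTop (0 : ℝ)] with x hx hx0
    rw [Real.norm_of_nonneg (Real.rpow_nonneg hx0 _)] at hx
    exact (le_abs_self _).trans hx
  have h2 : Tendsto (fun x : ℝ => 6 * x ^ (1 / 2 : ℝ)) atTop atTop :=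
    (tendsto_rpow_atTop (by norm_num)).const_mul_atTop (by norm_num)
  have h3 : ∀ᶠ x : ℝ in atTop, |C| * ε * Real.log x ≤ x := by
    have hc : 0 < 1 / (|C| * ε + 1) := by positivity
    filter_upwards [Real.isLittleO_log_id_atTop.def hc, eventually_ge_atTop (1 : ℝ)] with x hx hx1
    have hlx := Real.log_nonneg hx1
    rw [Real.norm_of_nonneg hlx, id, Real.norm_of_nonneg (by linarith), div_mul_eq_mul_div,
      one_mul, le_div_iff₀ (by positivity)] at hx
    nlinarith
  filter_upwards [hl.eventually h1, hl.eventually (h2.eventually_ge_atTop C),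
    tendsto_natCast_atTop_atTop.eventually h3,
    (Real.tendsto_log_atTop.comp hl).eventually_ge_atTop 1,
    hl.eventually_gt_atTop 1] with n h1 h2 h3 h4 h5
  simp only [Function.comp] at h4
  set x := Real.log n with hx
  have hx0 : 0 < x := by linarith
  have hlx : 0 < Real.log x := by linarith
  have hsq : x ^ (1 / 2 : ℝ) * x ^ (1 / 2 : ℝ) = x := by
    rw [← Real.rpow_add hx0]; norm_num
  have hr : 0 < x ^ (1 / 2 : ℝ) := Real.rpow_pos_of_pos hx0 _
  have hd : 6 * x ^ (1 / 2 : ℝ) ≤ ε * x / Real.log x := by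
    rw [le_div_iff₀ hlx]
    nlinarith
  have hlog : Real.log x / 2 ≤ Real.log (ε * x / Real.log x / 6) := by
    have : Real.log (x ^ (1 / 2 : ℝ)) ≤ Real.log (ε * x / Real.log x / 6) :=
      Real.log_le_log hr (by linarith)
    rw [Real.log_rpow hx0] at this
    linarith
  refine ⟨h2.trans hd, ?_, by linarith, ?_⟩
  · have e : ε * x / Real.log x ≤ ε * x := div_le_self (by positivity) h4
    have e0 : 0 ≤ ε * x / Real.log x := by positivity
    have e1 := mul_le_mul_of_nonneg_right (le_abs_self C) e0
    have e2 := mul_le_mul_of_nonneg_left e (abs_nonneg C)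
    linarith
  · calc x = 2 * (ε * x / Real.log x) / ε * (Real.log x / 2) := by field_simp
      _ ≤ _ := mul_le_mul_of_nonneg_left hlog (by positivity)

/-- For fixed `ε > 0` and `n` sufficiently large, every `(n, ε log n/log log n)`-expander
contains a Hamilton cycle. -/
theorem stmt17 (ε : ℝ) (hε : 0 < ε) :
    ∃ N : ℕ, ∀ n : ℕ, N ≤ n → ∀ H : SimpleGraph (Fin n),
      IsExpander H n (ε * Real.log n / Real.log (Real.log n)) →
      ∃ (v : Fin n) (c : H.Walk v v), c.IsHamiltonianCycle := by
  obtain ⟨q, hq⟩ := exists_nat_ge (476 / ε)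
  rw [div_le_iff₀ hε] at hq
  obtain ⟨N, hN⟩ := Filter.eventually_atTop.1 (Expander.eventually_log_div_log_log hε
    (max (max (100 * 2 ^ (4 * q)) ((18 + 4 * q) * ε)) (204 / ε)))
  refine ⟨N, fun n hn H hH => ?_⟩
  obtain ⟨h1, h2, h3, h4⟩ := hN n hn
  have hd1 := (le_max_left _ _).trans ((le_max_left _ _).trans h1)
  have hd2 := (le_max_right _ _).trans ((le_max_left _ _).trans h1)
  have hpow : (1 : ℝ) ≤ 2 ^ (4 * q) := one_le_pow₀ (by norm_num)
  have hd0 : 0 < ε * Real.log n / Real.log (Real.log n) := by linarith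
  refine hH.exists_isHamiltonianCycle hε hq hd1 hd2 ?_ ?_ h3 h4
  · refine (mul_le_mul_of_nonneg_right ?_ hd0.le).trans h2
    exact le_trans (by linarith) ((le_max_left _ _).trans (le_max_left _ _))
  · have := (mul_le_mul_of_nonneg_right (le_max_right _ _) hd0.le).trans h2
    rwa [div_mul_eq_mul_div, div_le_iff₀ hε] at this
end

section
/- Let m, n ∈ ℕ satisfy m ≤ n/800, let d = n/(200m), and let n be sufficiently large. Let G be a graph with n vertices such that every set A ⊆ V(G) with |A| = m satisfies |N(A)| ≥ (1 − 1/64)n. Suppose G contains pairwise disjoint vertex sets X = {x₁,...,x_{2m}}, Y = {y₁,...,y_{2m}} and U with |U| = ⌈n/8⌉, and suppose integers k_i for i ∈ [2m] satisfy 4 log n / log d ≤ k_i ≤ n/40. Then for some i ∈ [2m] there is a path in G from x_i to y_i of length k_i all of whose internal vertices lie in U. -/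
open Classical in
/-- The neighbourhood of `A` within `R`. -/
noncomputable def nbrIn {V : Type*} (G : SimpleGraph V) (R A : Finset V) : Finset V :=
  {v ∈ R | v ∉ A ∧ ∃ u ∈ A, G.Adj u v}

theorem mem_nbrIn {V : Type*} {G : SimpleGraph V} {R A : Finset V} {v : V} :
    v ∈ nbrIn G R A ↔ v ∈ R ∧ v ∉ A ∧ ∃ u ∈ A, G.Adj u v := by
  simp [nbrIn]

/-- Within `R`, at least `m` vertices can be reached from `v` by paths of length `c` which all
lie in one set of at most `t` vertices, apart from `v`. -/
def Spreads {V : Type*} (G : SimpleGraph V) (m c t : ℕ) (R : Finset V) (v : V) : Prop :=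
  ∃ T ⊆ R, T.card ≤ t ∧ ∃ A ⊆ T, A.card = m ∧
    ∀ a ∈ A, ∃ w : G.Walk v a, w.IsPath ∧ w.length = c ∧ ∀ z ∈ w.support, z = v ∨ z ∈ T

theorem Spreads.mono {V : Type*} {G : SimpleGraph V} {m c t : ℕ} {R R' : Finset V} {v : V}
    (h : Spreads G m c t R v) (hR : R ⊆ R') : Spreads G m c t R' v := by
  obtain ⟨T, hT, h⟩ := h
  exact ⟨T, hT.trans hR, h⟩

theorem Spreads.exists_adj {V : Type*} {G : SimpleGraph V} {m c t : ℕ} {R : Finset V} {v : V}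
    (h : Spreads G m c t R v) (hm : 0 < m) (hc : 0 < c) : ∃ u ∈ R, G.Adj v u := by
  obtain ⟨T, hT, -, A, -, hA, h⟩ := h
  obtain ⟨a, ha⟩ := Finset.card_pos.mp (hA ▸ hm)
  obtain ⟨w, -, hw, hs⟩ := h a ha
  cases w with
  | nil => simp at hw; omega
  | @cons _ u _ huv p =>
    refine ⟨u, ?_, huv⟩
    rcases hs u (by simp) with rfl | h
    · exact absurd huv G.irrefl
    · exact hT h

theorem isPath_append {V : Type*} {G : SimpleGraph V} {u v w : V} {p : G.Walk u v}
    {q : G.Walk v w} (hp : p.IsPath) (hq : q.IsPath)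
    (h : ∀ z ∈ p.support, z ∈ q.support → z = v) : (p.append q).IsPath := by
  induction p with
  | nil => simpa using hq
  | cons hadj p ih =>
    rw [SimpleGraph.Walk.cons_isPath_iff] at hp
    rw [SimpleGraph.Walk.cons_append, SimpleGraph.Walk.cons_isPath_iff]
    refine ⟨ih hp.1 hq fun z hz => h z (by simp [hz]), fun hmem => ?_⟩
    rcases (SimpleGraph.Walk.mem_support_append_iff _ _).mp hmem with h1 | h1
    · exact hp.2 h1
    · exact hp.2 (h _ (by simp) h1 ▸ p.end_mem_support)

/-- Depth-first search: if among any `m` vertices outside a large set some vertex spreads within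
that set, then a path of prescribed length into `W` from some root in `S` ends in a vertex that
spreads within the rest of `W`. -/
theorem exists_path_spreads {V : Type*} [DecidableEq V] {G : SimpleGraph V} {m c t r L : ℕ}
    (hm : 0 < m) (hc : 0 < c) {S W : Finset V} (hSW : Disjoint S W) (hS : m ≤ S.card)
    (ℓ : V → ℕ) (hℓ : ∀ s ∈ S, ℓ s ≤ L) (hW : r + m + L ≤ W.card)
    (hspread : ∀ F R : Finset V, F.card = m → Disjoint F R → r ≤ R.card →
      ∃ v ∈ F, Spreads G m c t R v) :
    ∃ s ∈ S, ∃ v, ∃ w : G.Walk v s, w.IsPath ∧ w.length = ℓ s ∧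
      (∀ z ∈ w.support, z = s ∨ z ∈ W) ∧ Spreads G m c t (W \ w.support.toFinset) v := by
  by_contra! hcon
  have key : ∀ a : ℕ, ∃ F : Finset V, F.card < m ∧ ∃ s ∈ S, ∃ v, ∃ w : G.Walk v s,
      w.IsPath ∧ w.length ≤ ℓ s ∧ (∀ z ∈ w.support, z = s ∨ z ∈ W) ∧
      (∀ z ∈ w.support, z ∉ F) ∧
      (∀ f ∈ F, ¬ Spreads G m c t ((W \ F) \ w.support.toFinset) f) ∧
      a ≤ 2 * F.card + w.length := by
    intro a
    induction a with
    | zero =>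
      obtain ⟨s, hs⟩ := Finset.card_pos.mp (hm.trans_le hS)
      exact ⟨∅, by simpa, s, hs, s, .nil, by simp, by simp, by simp, by simp, by simp, by simp⟩
    | succ a ih =>
      obtain ⟨F, hF, s, hs, v, w, hw, hwl, hwW, hwF, hbad, ha⟩ := ih
      by_cases hsp : Spreads G m c t ((W \ F) \ w.support.toFinset) v
      · have hlt : w.length < ℓ s := by
          refine hwl.lt_of_ne fun h => hcon s hs v w hw h hwW (hsp.mono ?_)
          exact Finset.sdiff_subset_sdiff Finset.sdiff_subset le_rfl
        obtain ⟨u, hu, hadj⟩ := hsp.exists_adj hm hc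
        simp only [Finset.mem_sdiff, List.mem_toFinset] at hu
        refine ⟨F, hF, s, hs, u, .cons hadj.symm w, ?_, ?_, ?_, ?_, ?_, ?_⟩
        · rw [SimpleGraph.Walk.cons_isPath_iff]
          exact ⟨hw, hu.2⟩
        · simpa using hlt
        · simpa using ⟨Or.inr hu.1.1, hwW⟩
        · simpa using ⟨hu.1.2, hwF⟩
        · intro f hf h
          refine hbad f hf (h.mono (Finset.sdiff_subset_sdiff le_rfl ?_))
          intro z hz
          simp only [List.mem_toFinset] at hz ⊢
          simp [hz]
        · simp; omega
      · have hvF : v ∉ F := hwF v (by simp)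
        have hcard : (insert v F).card = F.card + 1 := Finset.card_insert_of_notMem hvF
        have hbad' : ∀ f ∈ insert v F, ¬ Spreads G m c t ((W \ F) \ w.support.toFinset) f := by
          simpa using ⟨hsp, hbad⟩
        have hlt : (insert v F).card < m := by
          by_contra! hge
          obtain ⟨f, hf, hf'⟩ := hspread (insert v F) ((W \ F) \ w.support.toFinset)
            (by omega) (by
              rw [Finset.disjoint_left]
              intro z hz hz'
              simp only [Finset.mem_sdiff, List.mem_toFinset] at hz'
              rcases Finset.mem_insert.mp hz with rfl | h
              · exact hz'.2 (by simp)
              · exact hz'.1.2 h) (by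
              have h1 : W ⊆ ((W \ F) \ w.support.toFinset) ∪ F ∪ w.support.toFinset.erase s := by
                intro z hz
                have : z ≠ s := fun h => (Finset.disjoint_left.mp hSW hs) (h ▸ hz)
                simp only [Finset.mem_union, Finset.mem_sdiff, Finset.mem_erase]
                tauto
              have h2 := Finset.card_le_card h1
              have h3 := Finset.card_union_le ((W \ F) \ w.support.toFinset ∪ F)
                (w.support.toFinset.erase s)
              have h4 := Finset.card_union_le ((W \ F) \ w.support.toFinset) F
              have h5 : (w.support.toFinset.erase s).card + 1 = w.support.toFinset.card :=
                Finset.card_erase_add_one (by simp)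
              have h6 := List.toFinset_card_le w.support
              rw [SimpleGraph.Walk.length_support] at h6
              have := hℓ s hs
              omega)
          exact hbad' f hf hf'
        cases w with
        | nil =>
          obtain ⟨s', hs', hs'F⟩ := Finset.exists_mem_notMem_of_card_lt_card (hlt.trans_le hS)
          refine ⟨insert s F, hlt, s', hs', s', .nil, by simp, by simp, by simp,
            by simpa using hs'F, ?_, ?_⟩
          · intro f hf h
            refine hbad' f hf (h.mono fun z hz => ?_)
            simp at hz ⊢
            tauto
          · simp at ha ⊢; omega
        | @cons _ u _ hadj p =>
          rw [SimpleGraph.Walk.cons_isPath_iff] at hw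
          refine ⟨insert v F, hlt, s, hs, u, p, hw.1, ?_, ?_, ?_, ?_, ?_⟩
          · simp at hwl; omega
          · exact fun z hz => hwW z (by simp [hz])
          · intro z hz h
            rcases Finset.mem_insert.mp h with rfl | h
            · exact hw.2 hz
            · exact hwF z (by simp [hz]) h
          · intro f hf h
            refine hbad' f hf (h.mono fun z hz => ?_)
            simp at hz ⊢
            tauto
          · simp at ha; omega
  obtain ⟨F, hF, s, hs, v, w, -, hwl, -, -, -, ha⟩ := key (2 * m + L + 1)
  have := hℓ s hs
  omega

/-- If every `m`-set has at least `2 * D * m` neighbours in `R`, then after discarding fewer than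
`m` vertices every set of at most `m` vertices expands by a factor `D` into `R`. -/
theorem exists_small_obstruction {V : Type*} [Fintype V] [DecidableEq V] {G : SimpleGraph V}
    {m D : ℕ} (hm : 0 < m) (hD : 0 < D) {R : Finset V}
    (h : ∀ A : Finset V, A.card = m → 2 * D * m ≤ (nbrIn G R A).card) :
    ∃ B : Finset V, B.card < m ∧ ∀ A : Finset V, Disjoint A B → A.card ≤ m →
      ∃ C ⊆ R \ B, D * A.card ≤ C.card ∧ ∀ z ∈ C, ∃ u ∈ A, G.Adj u z := by
  classical
  obtain ⟨B, hB, hmax⟩ := Finset.exists_max_image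
    (Finset.univ.filter fun B : Finset V => B.card ≤ m ∧ (nbrIn G R B).card ≤ D * B.card)
    Finset.card ⟨∅, by
      rw [Finset.mem_filter]
      simp [nbrIn]⟩
  simp only [Finset.mem_filter, Finset.mem_univ, true_and] at hB hmax
  have hpos : 0 < D * m := Nat.mul_pos hD hm
  have hBm : B.card < m := by
    refine hB.1.lt_of_ne fun he => ?_
    have h1 := h B he
    have h2 := hB.2
    rw [he] at h2
    nlinarith
  refine ⟨B, hBm, fun A hAB hA => ?_⟩
  have hsub : ∀ A' ⊆ A, nbrIn G R (A' ∪ B) \ nbrIn G R B ⊆ R \ B ∧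
      ∀ z ∈ nbrIn G R (A' ∪ B) \ nbrIn G R B, ∃ u ∈ A, G.Adj u z := by
    intro A' hA'
    constructor
    · intro z hz
      simp only [Finset.mem_sdiff, mem_nbrIn, Finset.mem_union] at hz ⊢
      tauto
    · intro z hz
      simp only [Finset.mem_sdiff, mem_nbrIn, Finset.mem_union] at hz
      obtain ⟨⟨hzR, hzn, u, hu, huz⟩, hz2⟩ := hz
      rcases hu with hu | hu
      · exact ⟨u, hA' hu, huz⟩
      · exact absurd ⟨hzR, fun h => hzn (Or.inr h), u, hu, huz⟩ hz2
  have hdiff : ∀ A' : Finset V, (nbrIn G R (A' ∪ B)).card ≤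
      (nbrIn G R (A' ∪ B) \ nbrIn G R B).card + D * B.card := fun A' =>
    Finset.card_le_card_sdiff_add_card.trans (Nat.add_le_add_left hB.2 _)
  by_cases hc : (A ∪ B).card ≤ m
  · refine ⟨_, (hsub A le_rfl).1, ?_, (hsub A le_rfl).2⟩
    have hu : (A ∪ B).card = A.card + B.card := Finset.card_union_of_disjoint hAB
    rcases Nat.eq_zero_or_pos A.card with h0 | h0
    · simp [h0]
    · have h1 : D * (A ∪ B).card < (nbrIn G R (A ∪ B)).card := by
        by_contra! hle
        have := hmax (A ∪ B) ⟨hc, hle⟩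
        omega
      have h2 := hdiff A
      rw [hu, Nat.mul_add] at h1
      omega
  · have hu : (A ∪ B).card = A.card + B.card := Finset.card_union_of_disjoint hAB
    obtain ⟨A', hA', hcard⟩ := Finset.exists_subset_card_eq (s := A) (n := m - B.card) (by omega)
    refine ⟨_, (hsub A' hA').1, ?_, (hsub A' hA').2⟩
    have h1 := h (A' ∪ B) (by
      rw [Finset.card_union_of_disjoint (hAB.mono_left hA')]; omega)
    have h2 := hdiff A'
    have h3 : D * B.card ≤ D * m := Nat.mul_le_mul_left _ hBm.le
    have h4 : D * A.card ≤ D * m := Nat.mul_le_mul_left _ hA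
    have h5 : 2 * D * m = D * m + D * m := by ring
    omega

/-- Among any `m` vertices outside `R`, some vertex spreads within `R`. -/
theorem exists_spreads {V : Type*} [Fintype V] [DecidableEq V] {G : SimpleGraph V}
    {m q c : ℕ} (hm : 0 < m) (hq : 2 ≤ q) (hc : q ^ c ≤ m) (hc' : m ≤ q ^ (c + 1))
    {F R : Finset V} (hF : F.card = m) (hFR : Disjoint F R)
    (h : ∀ A : Finset V, A.card = m → 2 * (q + 2) * m ≤ (nbrIn G R A).card) :
    ∃ v ∈ F, Spreads G m (c + 1) (2 * (q * m)) R v := by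
  obtain ⟨B, hBm, hB⟩ := exists_small_obstruction hm (by omega) h
  obtain ⟨v, hvF, hvB⟩ := Finset.exists_mem_notMem_of_card_lt_card (hF ▸ hBm)
  have hvR : v ∉ R := Finset.disjoint_left.mp hFR hvF
  refine ⟨v, hvF, ?_⟩
  have key : ∀ j ≤ c + 1, ∃ T ⊆ R \ B, T.card ≤ 2 * q ^ j ∧ ∃ A ⊆ insert v T, A.card = q ^ j ∧
      (0 < j → A ⊆ T) ∧ ∀ a ∈ A, ∃ w : G.Walk v a, w.IsPath ∧ w.length = j ∧
        ∀ z ∈ w.support, z = v ∨ z ∈ T := by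
    intro j
    induction j with
    | zero =>
      intro _
      refine ⟨∅, by simp, by simp, {v}, by simp, by simp, by simp, ?_⟩
      intro a ha
      obtain rfl := Finset.mem_singleton.mp ha
      exact ⟨.nil, by simp, by simp, by simp⟩
    | succ j ih =>
      intro hj
      obtain ⟨T, hT, hTc, A, hA, hAc, -, hpath⟩ := ih (by omega)
      have hAm : A.card ≤ m :=
        hAc ▸ (Nat.pow_le_pow_right (by omega) (by omega : j ≤ c)).trans hc
      obtain ⟨C, hC, hCc, hCadj⟩ := hB A (by
        rw [Finset.disjoint_left]
        intro z hz hzB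
        rcases Finset.mem_insert.mp (hA hz) with rfl | hz
        · exact hvB hzB
        · exact (Finset.mem_sdiff.mp (hT hz)).2 hzB) hAm
      obtain ⟨A', hA', hA'c⟩ := Finset.exists_subset_card_eq (s := C \ T) (n := q ^ (j + 1)) (by
        have h1 := Finset.le_card_sdiff T C
        rw [hAc, Nat.add_mul] at hCc
        rw [pow_succ, mul_comm]
        omega)
      refine ⟨T ∪ A', ?_, ?_, A', ?_, hA'c, fun _ => Finset.subset_union_right, ?_⟩
      · exact Finset.union_subset hT (hA'.trans (Finset.sdiff_subset.trans hC))
      · have h1 := Finset.card_union_le T A'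
        have h2 : q ^ j * 2 ≤ q ^ j * q := Nat.mul_le_mul_left _ hq
        rw [← pow_succ] at h2
        omega
      · exact Finset.subset_union_right.trans (Finset.subset_insert _ _)
      · intro a ha
        have haC := Finset.mem_sdiff.mp (hA' ha)
        obtain ⟨u, hu, hua⟩ := hCadj a haC.1
        obtain ⟨w, hw, hwl, hws⟩ := hpath u hu
        refine ⟨w.concat hua, ?_, by simp [hwl], ?_⟩
        · refine hw.concat ?_ hua
          intro hmem
          rcases hws a hmem with rfl | h'
          · exact hvR (Finset.mem_sdiff.mp (hC haC.1)).1
          · exact haC.2 h'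
        · intro z hz
          rw [SimpleGraph.Walk.support_concat] at hz
          simp only [List.mem_append, List.mem_singleton] at hz
          rcases hz with hz | rfl
          · rcases hws z hz with h' | h'
            · exact Or.inl h'
            · exact Or.inr (Finset.mem_union_left _ h')
          · exact Or.inr (Finset.mem_union_right _ ha)
  obtain ⟨T, hT, hTc, A, -, hAc, hAT, hpath⟩ := key (c + 1) le_rfl
  obtain ⟨A', hA', hA'c⟩ := Finset.exists_subset_card_eq (s := A) (n := m) (by omega)
  refine ⟨T, hT.trans Finset.sdiff_subset, hTc.trans ?_, A', hA'.trans (hAT (by omega)), hA'c,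
    fun a ha => hpath a (hA' ha)⟩
  rw [pow_succ, mul_comm (q ^ c)]
  gcongr

/-- Two spreading vertices at the ends of disjoint paths are joined through a common neighbour
of the sets they reach. -/
theorem exists_path_of_spreads {V : Type*} [Fintype V] [DecidableEq V] {G : SimpleGraph V}
    {m c t e : ℕ} {x y v : V} {U U₁ U₂ : Finset V} (hU₁ : U₁ ⊆ U) (hU₂ : U₂ ⊆ U)
    (hdisj : Disjoint U₁ U₂) (hxy : x ≠ y) (hx : x ∉ U) (hy : y ∉ U)
    (hN : ∀ A : Finset V, A.card = m → U.card ≤ (nbrIn G U A).card + e)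
    (p : G.Walk v x) (hp : p.IsPath) (hpU : ∀ z ∈ p.support, z = x ∨ z ∈ U₁)
    (hv : Spreads G m c t (U₁ \ p.support.toFinset) v) (hyS : Spreads G m c t U₂ y)
    (hcard : p.length + 2 * t + 2 * e < U.card) :
    ∃ w : G.Walk x y, w.IsPath ∧ w.length = p.length + 2 * c + 2 ∧
      ∀ z ∈ w.support, z ≠ x → z ≠ y → z ∈ U := by
  obtain ⟨T, hT, hTc, A, hAT, hAc, hA⟩ := hv
  obtain ⟨T', hT', hTc', A', hAT', hAc', hA'⟩ := hyS
  obtain ⟨w, hw⟩ : (((nbrIn G U A ∩ nbrIn G U A') \ (p.support.toFinset.erase x)) \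
      (T ∪ T')).Nonempty := by
    rw [← Finset.card_pos]
    have h1 := hN A hAc
    have h2 := hN A' hAc'
    have h3 := Finset.card_union_add_card_inter (nbrIn G U A) (nbrIn G U A')
    have h4 : (nbrIn G U A ∪ nbrIn G U A').card ≤ U.card := by
      refine Finset.card_le_card (Finset.union_subset ?_ ?_) <;>
        exact fun z hz => (mem_nbrIn.mp hz).1
    have h5 := Finset.le_card_sdiff (p.support.toFinset.erase x) (nbrIn G U A ∩ nbrIn G U A')
    have h6 := Finset.le_card_sdiff (T ∪ T')
      ((nbrIn G U A ∩ nbrIn G U A') \ (p.support.toFinset.erase x))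
    have h7 := Finset.card_union_le T T'
    have h8 : (p.support.toFinset.erase x).card + 1 = p.support.toFinset.card :=
      Finset.card_erase_add_one (by simp)
    have h9 := List.toFinset_card_le p.support
    rw [SimpleGraph.Walk.length_support] at h9
    omega
  simp only [Finset.mem_sdiff, Finset.mem_inter, mem_nbrIn, Finset.mem_union, Finset.mem_erase,
    List.mem_toFinset] at hw
  obtain ⟨⟨⟨⟨hwU, hwA, a, ha, haw⟩, -, hwA', b, hb, hbw⟩, hwp⟩, hwT⟩ := hw
  have hwx : w ≠ x := fun h => hx (h ▸ hwU)
  have hwy : w ≠ y := fun h => hy (h ▸ hwU)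
  obtain ⟨p₁, hp₁, hl₁, hs₁⟩ := hA a ha
  obtain ⟨p₂, hp₂, hl₂, hs₂⟩ := hA' b hb
  have hq₁ : (p.reverse.append p₁).IsPath := by
    refine isPath_append hp.reverse hp₁ fun z hz hz' => ?_
    rw [SimpleGraph.Walk.support_reverse, List.mem_reverse] at hz
    refine (hs₁ z hz').resolve_right fun h => ?_
    have := hT h
    simp only [Finset.mem_sdiff, List.mem_toFinset] at this
    exact this.2 hz
  have hmem₁ : ∀ z ∈ (p.reverse.append p₁).support, z ∈ p.support ∨ z ∈ T := by
    intro z hz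
    rw [SimpleGraph.Walk.mem_support_append_iff, SimpleGraph.Walk.support_reverse,
      List.mem_reverse] at hz
    rcases hz with hz | hz
    · exact Or.inl hz
    · rcases hs₁ z hz with rfl | h
      · exact Or.inl (by simp)
      · exact Or.inr h
  have hTU : ∀ z ∈ T, z ∈ U₁ := fun z hz => (Finset.mem_sdiff.mp (hT hz)).1
  have hmemU : ∀ z ∈ (p.reverse.append p₁).support, z = x ∨ z ∈ U₁ := by
    intro z hz
    rcases hmem₁ z hz with h | h
    · exact hpU z h
    · exact Or.inr (hTU z h)
  have hq₂ : (SimpleGraph.Walk.cons hbw.symm p₂.reverse).IsPath := by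
    rw [SimpleGraph.Walk.cons_isPath_iff]
    refine ⟨hp₂.reverse, fun h => ?_⟩
    rw [SimpleGraph.Walk.support_reverse, List.mem_reverse] at h
    rcases hs₂ w h with h | h
    · exact hwy h
    · exact hwT (Or.inr h)
  have hcross : ∀ z ∈ (p.reverse.append p₁).support,
      z ∉ (SimpleGraph.Walk.cons hbw.symm p₂.reverse).support := by
    intro z hz hz'
    rw [SimpleGraph.Walk.support_cons, List.mem_cons, SimpleGraph.Walk.support_reverse,
      List.mem_reverse] at hz'
    rcases hz' with rfl | hz'
    · rcases hmem₁ z hz with h | h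
      · exact hwp ⟨hwx, h⟩
      · exact hwT (Or.inl h)
    · rcases hmemU z hz with rfl | h <;> rcases hs₂ z hz' with rfl | h'
      · exact hxy rfl
      · exact hx (hU₂ (hT' h'))
      · exact hy (hU₁ h)
      · exact Finset.disjoint_left.mp hdisj h (hT' h')
  refine ⟨(p.reverse.append p₁).append (.cons haw (.cons hbw.symm p₂.reverse)), ?_, ?_, ?_⟩
  · refine isPath_append hq₁ ?_ fun z hz hz' => ?_
    · rw [SimpleGraph.Walk.cons_isPath_iff]
      exact ⟨hq₂, hcross a (by simp)⟩
    · rw [SimpleGraph.Walk.support_cons, List.mem_cons] at hz'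
      exact hz'.resolve_right (hcross z hz)
  · simp [hl₁, hl₂]; omega
  · intro z hz hzx hzy
    rw [SimpleGraph.Walk.mem_support_append_iff] at hz
    rcases hz with hz | hz
    · exact hU₁ ((hmemU z hz).resolve_left hzx)
    · simp only [SimpleGraph.Walk.support_cons, List.mem_cons, SimpleGraph.Walk.support_reverse,
        List.mem_reverse] at hz
      rcases hz with rfl | rfl | hz
      · exact hU₁ (hTU _ (hAT ha))
      · exact hwU
      · exact hU₂ (hT' ((hs₂ z hz).resolve_left hzy))

/-- If every `m`-set has all but at most `e` vertices as external neighbours and `U` is large, then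
one of `2 * m` pairs is joined through `U` by a path of its prescribed length. -/
theorem exists_path_of_expanding {V : Type*} [Fintype V] [DecidableEq V] {G : SimpleGraph V}
    {m q c e K : ℕ} (hm : 0 < m) (hq : 2 ≤ q) (hc : q ^ c ≤ m) (hc' : m ≤ q ^ (c + 1))
    (hN : ∀ A : Finset V, A.card = m → ∀ R : Finset V, R.card ≤ (nbrIn G R A).card + e)
    {x y : Fin (2 * m) → V} {U : Finset V} (hx : Function.Injective x)
    (hy : Function.Injective y) (hxy : ∀ i, x i ≠ y i) (hxU : ∀ i, x i ∉ U) (hyU : ∀ i, y i ∉ U)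
    {k : Fin (2 * m) → ℕ} (hk : ∀ i, 2 * (c + 1) + 2 ≤ k i) (hkK : ∀ i, k i ≤ K)
    (hU : (2 * (q + 2) * m + e) + m + K + (2 * (q + 2) * m + e) ≤ U.card) :
    ∃ i, ∃ w : G.Walk (x i) (y i), w.IsPath ∧ w.length = k i ∧
      ∀ v ∈ w.support, v ≠ x i → v ≠ y i → v ∈ U := by
  obtain ⟨U₁, hU₁, hU₁c⟩ := Finset.exists_subset_card_eq (s := U)
    (n := (2 * (q + 2) * m + e) + m + K) (by omega)
  have hU₂c : (U \ U₁).card + U₁.card = U.card := Finset.card_sdiff_add_card_eq_card hU₁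
  have hspread : ∀ F R : Finset V, F.card = m → Disjoint F R → 2 * (q + 2) * m + e ≤ R.card →
      ∃ v ∈ F, Spreads G m (c + 1) (2 * (q * m)) R v := by
    intro F R hF hFR hR
    refine exists_spreads hm hq hc hc' hF hFR fun A hA => ?_
    have := hN A hA R
    omega
  classical
  have hI : m ≤ (Finset.univ.filter fun i =>
      Spreads G m (c + 1) (2 * (q * m)) (U \ U₁) (y i)).card := by
    by_contra! hlt
    have hsum := Finset.card_filter_add_card_filter_not (s := (Finset.univ : Finset (Fin (2 * m))))
      (fun i => Spreads G m (c + 1) (2 * (q * m)) (U \ U₁) (y i))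
    rw [Finset.card_univ, Fintype.card_fin] at hsum
    obtain ⟨J, hJ, hJc⟩ := Finset.exists_subset_card_eq (n := m) (s := Finset.univ.filter fun i =>
      ¬ Spreads G m (c + 1) (2 * (q * m)) (U \ U₁) (y i)) (by omega)
    obtain ⟨v, hv, hvs⟩ := hspread (J.image y) (U \ U₁)
      (by rw [Finset.card_image_of_injective _ hy, hJc]) (by
        rw [Finset.disjoint_left]
        intro z hz hz'
        obtain ⟨i, -, rfl⟩ := Finset.mem_image.mp hz
        exact hyU i (Finset.mem_sdiff.mp hz').1) (by omega)
    obtain ⟨i, hi, rfl⟩ := Finset.mem_image.mp hv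
    exact (Finset.mem_filter.mp (hJ hi)).2 hvs
  set I := Finset.univ.filter fun i => Spreads G m (c + 1) (2 * (q * m)) (U \ U₁) (y i) with hIdef
  have : Nonempty (Fin (2 * m)) := ⟨⟨0, by omega⟩⟩
  have hinv : ∀ i, Function.invFun x (x i) = i := Function.leftInverse_invFun hx
  obtain ⟨s, hs, v, p, hp, hpl, hpU, hv⟩ := exists_path_spreads (L := K) (S := I.image x) hm
    (Nat.succ_pos c) (by
      rw [Finset.disjoint_left]
      intro z hz hz'
      obtain ⟨i, -, rfl⟩ := Finset.mem_image.mp hz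
      exact hxU i (hU₁ hz')) (by rwa [Finset.card_image_of_injective _ hx])
    (fun s => k (Function.invFun x s) - (2 * (c + 1) + 2))
    (fun s _ => (Nat.sub_le _ _).trans (hkK _)) hU₁c.ge hspread
  obtain ⟨i, hi, rfl⟩ := Finset.mem_image.mp hs
  simp only [hinv] at hpl
  have hki := hk i
  have hKi := hkK i
  have hqm : 2 * (q + 2) * m = 2 * (q * m) + 4 * m := by ring
  obtain ⟨w, hw, hwl, hwU⟩ := exists_path_of_spreads hU₁ Finset.sdiff_subset
    Finset.disjoint_sdiff (hxy i) (hxU i) (hyU i) (fun A hA => hN A hA U) p hp hpU hv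
    (Finset.mem_filter.mp hi).2 (by omega)
  exact ⟨i, w, hw, by omega, hwU⟩

/-- For `n` large, `m ≤ n/800`, `d = n/200m`: if every `m`-set `A` of the `n`-vertex
graph `G` has `|N(A)| ≥ (1-1/64)n`, and `G` has disjoint sets `X = {x₁,…,x_{2m}}`,
`Y = {y₁,…,y_{2m}}`, `U` with `|U| = ⌈n/8⌉`, and `4 log n/log d ≤ kᵢ ≤ n/40` for each
`i`, then for some `i` there is an `xᵢ,yᵢ`-path of length `kᵢ` with all internal
vertices in `U`. -/
theorem stmt19 :
    ∃ N : ℕ, ∀ n : ℕ, N ≤ n → ∀ m : ℕ, (m : ℝ) ≤ (n : ℝ) / 800 →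
      ∀ G : SimpleGraph (Fin n),
        (∀ A : Finset (Fin n), A.card = m → (1 - 1 / 64) * n ≤ ((nbr G A).ncard : ℝ)) →
        ∀ (x y : Fin (2 * m) → Fin n) (U : Finset (Fin n)),
          Function.Injective x → Function.Injective y →
          (∀ i j, x i ≠ y j) → (∀ i, x i ∉ U) → (∀ i, y i ∉ U) →
          U.card = ⌈(n : ℝ) / 8⌉₊ →
          ∀ k : Fin (2 * m) → ℕ,
            (∀ i, 4 * Real.log n / Real.log ((n : ℝ) / (200 * m)) ≤ k i ∧
              (k i : ℝ) ≤ (n : ℝ) / 40) →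
            ∃ i, ∃ w : G.Walk (x i) (y i), w.IsPath ∧ w.length = k i ∧
              ∀ v ∈ w.support, v ≠ x i → v ≠ y i → v ∈ U := by
  refine ⟨1, fun n hn m hmn G hG x y U hx hy hxy hxU hyU hU k hk => ?_⟩
  have hn0 : (0 : ℝ) < n := by exact_mod_cast hn
  have hm : 0 < m := by
    rw [Nat.pos_iff_ne_zero]
    rintro rfl
    have h := hG ∅ rfl
    have h0 : nbr G ∅ = ∅ := by simp [nbr]
    rw [h0, Set.ncard_empty] at h
    norm_num at h
    linarith
  have hm0 : (1 : ℝ) ≤ m := by exact_mod_cast hm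
  set d : ℝ := (n : ℝ) / (200 * m) with hd
  have hdm : d * m = n / 200 := by rw [hd]; field_simp
  have hd4 : 4 ≤ d := by rw [hd, le_div_iff₀ (by positivity)]; linarith
  have hlogd : 0 < Real.log d := Real.log_pos (by linarith)
  set q : ℕ := ⌈d⌉₊ with hqdef
  have hdq : d ≤ q := Nat.le_ceil d
  have hqd : (q : ℝ) < d + 1 := Nat.ceil_lt_add_one (by linarith)
  have hq : 2 ≤ q := by
    have : (2 : ℝ) ≤ q := by linarith
    exact_mod_cast this
  have hpow : q ^ Nat.log q m ≤ m := Nat.pow_log_le_self q hm.ne'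
  refine exists_path_of_expanding (e := n / 64) (K := n / 40) hm hq hpow
    (Nat.lt_pow_succ_log_self (by omega) m).le ?_ hx hy (fun i => hxy i i) hxU hyU ?_ ?_ ?_
  · intro A hA R
    have h1 := hG A hA
    have h2 : R ⊆ nbrIn G R A ∪ (Finset.univ \ nbrIn G Finset.univ A) := by
      intro z hz
      simp only [Finset.mem_union, Finset.mem_sdiff, mem_nbrIn, Finset.mem_univ, true_and]
      exact (em _).imp_left fun h => ⟨hz, h⟩
    have h3 : nbr G A = (nbrIn G Finset.univ A : Set (Fin n)) := by
      ext z
      simp [nbr, mem_nbrIn]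
    rw [h3, Set.ncard_coe_finset] at h1
    have h4 := (Finset.card_le_card h2).trans (Finset.card_union_le _ _)
    have h5 := Finset.card_sdiff_add_card_eq_card (Finset.subset_univ (nbrIn G Finset.univ A))
    rw [Finset.card_univ, Fintype.card_fin] at h5
    have h6 : 63 * n ≤ 64 * (nbrIn G Finset.univ A).card := by
      have : (63 * n : ℝ) ≤ 64 * (nbrIn G Finset.univ A).card := by linarith
      exact_mod_cast this
    omega
  · intro i
    have hlog : (Nat.log q m : ℝ) * Real.log d ≤ Real.log m := by
      rw [← Real.log_pow]
      refine Real.log_le_log (by positivity) ?_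
      calc d ^ Nat.log q m ≤ (q : ℝ) ^ Nat.log q m := by gcongr
        _ ≤ m := by exact_mod_cast hpow
    have hdmlog : Real.log d + Real.log m ≤ Real.log n := by
      rw [← Real.log_mul (by positivity) (by positivity), hdm]
      exact Real.log_le_log (by positivity) (by linarith)
    have hlogm : 0 ≤ Real.log m := Real.log_nonneg hm0
    have h := (hk i).1
    rw [div_le_iff₀ hlogd] at h
    have h2 : ((2 * (Nat.log q m + 1) + 2 : ℕ) : ℝ) * Real.log d ≤ k i * Real.log d := by
      push_cast
      linarith
    exact_mod_cast le_of_mul_le_mul_right h2 hlogd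
  · intro i
    rw [Nat.le_div_iff_mul_le (by norm_num)]
    have h := (hk i).2
    rw [le_div_iff₀ (by norm_num)] at h
    exact_mod_cast h
  · rw [hU]
    have h1 : ((n / 64 : ℕ) : ℝ) ≤ n / 64 := by exact_mod_cast Nat.cast_div_le
    have h2 : ((n / 40 : ℕ) : ℝ) ≤ n / 40 := by exact_mod_cast Nat.cast_div_le
    have h3 : (q : ℝ) * m ≤ n / 200 + m := by rw [← hdm]; nlinarith
    have h4 := Nat.le_ceil ((n : ℝ) / 8)
    rw [← Nat.cast_le (α := ℝ)]
    push_cast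
    linarith
end
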